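/- arXiv:0902.4754 — 10 statements merged into one kernel-verified Lean document; each statement's English description precedes it below -/
import Mathlib

section
/- Let n ≥ 1, N ≥ 0, and let F : ℝ × (ℝⁿ)^(N+1) → ℝ be smooth, viewed as a function F(t, q₀, q₁, …, q_N) of time and the jet (derivative) variables. For a smooth curve q : ℝ → ℝⁿ write j(q)(t) := (t, q(t), q'(t), …, q^(N)(t)). Then the following are equivalent: (i) for every smooth curve q : ℝ → ℝⁿ, every t ∈ ℝ and every index A ∈ {1,…,n}, Σ_{k=0}^{N} (−1)^k (d/dt)^k [ (∂F/∂(q_k)^A)(j(q)(t)) ] = 0 (the Euler–Lagrange derivative of F vanishes identically along all curves); (ii) there exists a smooth function K : ℝ × (ℝⁿ)^(N+1) → ℝ such that for every smooth curve q and every t ∈ ℝ, F(j(q)(t)) = (d/dt)[ K(j(q)(t)) ] (F is a total time derivative). -/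
open scoped BigOperators

/-- The jet (prolongation) of a curve `q : ℝ → ℝⁿ` up to order `N`:
`jet n N q t = (t, q(t), q'(t), …, q^(N)(t))`. -/
noncomputable def jet (n N : ℕ) (q : ℝ → Fin n → ℝ) (t : ℝ) :
    ℝ × (Fin (N + 1) → Fin n → ℝ) :=
  (t, fun k => iteratedDeriv (k : ℕ) q t)

open Set Filter Topology MeasureTheory
open scoped ContDiff

section ParametricIntegral

variable {E : Type} [NormedAddCommGroup E] [NormedSpace ℝ E] [ProperSpace E]
  {F : Type} [NormedAddCommGroup F] [NormedSpace ℝ F]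

theorem hasFDerivAt_intervalIntegral_of_contDiff {G : E × ℝ → F} (hG : ContDiff ℝ 1 G)
    (a b : ℝ) (x₀ : E) :
    HasFDerivAt (fun x => ∫ u in a..b, G (x, u))
      (∫ u in a..b, (fderiv ℝ G (x₀, u)).comp (ContinuousLinearMap.inl ℝ E ℝ)) x₀ := by
  have hcont : Continuous fun p : E × ℝ =>
      (fderiv ℝ G p).comp (ContinuousLinearMap.inl ℝ E ℝ) :=
    (hG.continuous_fderiv one_ne_zero).clm_comp continuous_const
  obtain ⟨C, hC⟩ := ((isCompact_closedBall x₀ 1).prod (isCompact_uIcc (a := a) (b := b))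
    ).exists_bound_of_continuousOn hcont.continuousOn
  refine intervalIntegral.hasFDerivAt_integral_of_dominated_of_fderiv_le
    (F := fun x u => G (x, u))
    (F' := fun x u => (fderiv ℝ G (x, u)).comp (ContinuousLinearMap.inl ℝ E ℝ))
    (bound := fun _ => C) (Metric.closedBall_mem_nhds x₀ one_pos) ?_ ?_ ?_ ?_ ?_ ?_
  · exact Eventually.of_forall fun x =>
      (hG.continuous.comp (Continuous.prodMk_right x)).aestronglyMeasurable
  · exact (hG.continuous.comp (Continuous.prodMk_right x₀)).intervalIntegrable a b
  · exact (hcont.comp (Continuous.prodMk_right x₀)).aestronglyMeasurable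
  · exact Eventually.of_forall fun u hu x hx => hC (x, u) ⟨hx, uIoc_subset_uIcc hu⟩
  · exact intervalIntegrable_const
  · exact Eventually.of_forall fun u _ x _ =>
      (hG.differentiable one_ne_zero (x, u)).hasFDerivAt.comp x (hasFDerivAt_prodMk_left x u)

theorem contDiff_nat_intervalIntegral {G : E × ℝ → F} (a b : ℝ) (m : ℕ) (hG : ContDiff ℝ m G) :
    ContDiff ℝ m fun x => ∫ u in a..b, G (x, u) := by
  induction m generalizing F with
  | zero =>
    have hG' : Continuous G := contDiff_zero.1 (by exact_mod_cast hG)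
    exact_mod_cast contDiff_zero.2
      (intervalIntegral.continuous_parametric_intervalIntegral_of_continuous'
        (f := fun x u => G (x, u)) hG' a b)
  | succ m ih =>
    push_cast at hG ⊢
    refine contDiff_succ_iff_hasFDerivAt.2 ⟨_, ?_,
      fun x => hasFDerivAt_intervalIntegral_of_contDiff (hG.of_le le_add_self) a b x⟩
    exact ih (G := fun p => (fderiv ℝ G p).comp (ContinuousLinearMap.inl ℝ E ℝ))
      ((hG.fderiv_right le_rfl).clm_comp contDiff_const)

theorem contDiff_infty_intervalIntegral {G : E × ℝ → F} (a b : ℝ) (hG : ContDiff ℝ ∞ G) :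
    ContDiff ℝ ∞ fun x => ∫ u in a..b, G (x, u) :=
  contDiff_infty.2 fun m => contDiff_nat_intervalIntegral a b m (contDiff_infty.1 hG m)

end ParametricIntegral

section IteratedDeriv

theorem contDiff_infty_iteratedDeriv {E : Type*} [NormedAddCommGroup E] [NormedSpace ℝ E]
    {f : ℝ → E} (hf : ContDiff ℝ ∞ f) (k : ℕ) : ContDiff ℝ ∞ (iteratedDeriv k f) := by
  rw [iteratedDeriv_eq_iterate]
  exact hf.iterate_deriv k

theorem hasDerivAt_iteratedDeriv {E : Type*} [NormedAddCommGroup E] [NormedSpace ℝ E]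
    {f : ℝ → E} (hf : ContDiff ℝ ∞ f) (k : ℕ) (t : ℝ) :
    HasDerivAt (iteratedDeriv k f) (iteratedDeriv (k + 1) f t) t := by
  rw [iteratedDeriv_succ]
  exact ((contDiff_infty_iteratedDeriv hf k).differentiable (by simp) t).hasDerivAt

theorem iteratedDeriv_apply {ι : Type*} [Fintype ι] {f : ℝ → ι → ℝ} (hf : ContDiff ℝ ∞ f)
    (i : ι) (k : ℕ) (t : ℝ) :
    iteratedDeriv k (fun s => f s i) t = iteratedDeriv k f t i := by
  induction k generalizing t with
  | zero => simp
  | succ k ih =>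
    rw [iteratedDeriv_succ, funext ih]
    exact (hasDerivAt_pi.1 (hasDerivAt_iteratedDeriv hf k t) i).deriv

/-- Iterated integration by parts when the boundary terms vanish. -/
theorem intervalIntegral_mul_iteratedDeriv {f g : ℝ → ℝ} (hf : ContDiff ℝ ∞ f)
    (hg : ContDiff ℝ ∞ g) (a b : ℝ) (k : ℕ) (ha : ∀ i < k, iteratedDeriv i g a = 0)
    (hb : ∀ i < k, iteratedDeriv i g b = 0) :
    ∫ s in a..b, f s * iteratedDeriv k g s =
      ∫ s in a..b, (-1) ^ k * iteratedDeriv k f s * g s := by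
  induction k generalizing f with
  | zero => simp
  | succ k ih =>
    have hf' : ContDiff ℝ ∞ (deriv f) := (contDiff_infty_iff_deriv.1 hf).2
    rw [intervalIntegral.integral_mul_deriv_eq_deriv_mul
      (fun s _ => (hf.differentiable (by simp) s).hasDerivAt)
      (fun s _ => hasDerivAt_iteratedDeriv hg k s)
      (hf'.continuous.intervalIntegrable a b)
      ((contDiff_infty_iteratedDeriv hg _).continuous.intervalIntegrable a b),
      ha k k.lt_succ_self, hb k k.lt_succ_self,
      ih hf' (fun i hi => ha i (hi.trans k.lt_succ_self))
        (fun i hi => hb i (hi.trans k.lt_succ_self)), iteratedDeriv_succ']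
    simp [pow_succ]

end IteratedDeriv

section Jet

variable {n N : ℕ} {q η : ℝ → Fin n → ℝ}

theorem contDiff_jet (hq : ContDiff ℝ ∞ q) : ContDiff ℝ ∞ (jet n N q) :=
  contDiff_id.prodMk (contDiff_pi.2 fun k => contDiff_infty_iteratedDeriv hq k)

theorem contDiff_add_smul (hq : ContDiff ℝ ∞ q) (hη : ContDiff ℝ ∞ η) (l : ℝ) :
    ContDiff ℝ ∞ fun s => q s + l • η s :=
  hq.add (hη.const_smul l)

theorem jet_add_smul (hq : ContDiff ℝ ∞ q) (hη : ContDiff ℝ ∞ η) (l s : ℝ) :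
    jet n N (fun s => q s + l • η s) s = jet n N q s + l • (0, (jet n N η s).2) := by
  refine Prod.ext (by simp [jet]) (funext fun k => ?_)
  change iteratedDeriv k (q + l • η) s = _
  have hlη : ContDiff ℝ ∞ (l • η) := hη.const_smul l
  rw [iteratedDeriv_add (contDiff_infty.1 hq k).contDiffAt (contDiff_infty.1 hlη k).contDiffAt,
    iteratedDeriv_const_smul_field]
  rfl

theorem jet_congr_of_eventuallyEq {t : ℝ} (h : q =ᶠ[𝓝 t] η) : jet n N q t = jet n N η t :=
  Prod.ext rfl (funext fun k => (h.iteratedDeriv k).eq_of_nhds)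

theorem jet_zero (t : ℝ) : jet n N 0 t = (t, 0) := by
  refine Prod.ext rfl (funext fun k => ?_)
  change iteratedDeriv k (fun _ => (0 : Fin n → ℝ)) t = 0
  simp

theorem eq_sum_smul_single (p : Fin (N + 1) → Fin n → ℝ) :
    ((0 : ℝ), p) = ∑ A, ∑ k, p k A • ((0 : ℝ), Pi.single k (Pi.single A (1 : ℝ))) := by
  refine Prod.ext (by simp [Prod.fst_sum]) (funext fun k => funext fun A => ?_)
  simp only [Prod.snd_sum, Prod.smul_snd, Finset.sum_apply, Pi.smul_apply, smul_eq_mul]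
  rw [Finset.sum_eq_single A, Finset.sum_eq_single k]
  · simp
  · intro j _ hj
    simp [Pi.single_eq_of_ne' hj]
  · simp
  · intro B _ hB
    refine Finset.sum_eq_zero fun j _ => ?_
    rcases eq_or_ne j k with rfl | hj
    · simp [Pi.single_eq_of_ne' hB]
    · simp [Pi.single_eq_of_ne' hj]
  · simp

/-- The Euler–Lagrange derivative of `F` with respect to `q^A`, along the curve `q`. -/
noncomputable def eulerLagrange (F : ℝ × (Fin (N + 1) → Fin n → ℝ) → ℝ) (q : ℝ → Fin n → ℝ)
    (A : Fin n) (t : ℝ) : ℝ :=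
  ∑ k : Fin (N + 1), (-1 : ℝ) ^ (k : ℕ) *
    iteratedDeriv (k : ℕ)
      (fun s => fderiv ℝ F (jet n N q s) ((0 : ℝ), Pi.single k (Pi.single A (1 : ℝ)))) t

variable {F : ℝ × (Fin (N + 1) → Fin n → ℝ) → ℝ}

theorem contDiff_fderiv_jet_apply (hF : ContDiff ℝ ∞ F) (hq : ContDiff ℝ ∞ q)
    (v : ℝ × (Fin (N + 1) → Fin n → ℝ)) :
    ContDiff ℝ ∞ fun s => fderiv ℝ F (jet n N q s) v :=
  ((hF.fderiv_right (by simp)).comp (contDiff_jet hq)).clm_apply contDiff_const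

theorem contDiff_eulerLagrange (hF : ContDiff ℝ ∞ F) (hq : ContDiff ℝ ∞ q) (A : Fin n) :
    ContDiff ℝ ∞ (eulerLagrange F q A) :=
  ContDiff.sum fun k _ => contDiff_const.mul
    (contDiff_infty_iteratedDeriv (contDiff_fderiv_jet_apply hF hq _) k)

theorem intervalIntegral_fderiv_jet (hF : ContDiff ℝ ∞ F) (hq : ContDiff ℝ ∞ q)
    (hη : ContDiff ℝ ∞ η) {a b : ℝ} (ha : (jet n N η a).2 = 0) (hb : (jet n N η b).2 = 0) :
    ∫ s in a..b, fderiv ℝ F (jet n N q s) (0, (jet n N η s).2) =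
      ∫ s in a..b, ∑ A, eulerLagrange F q A s * η s A := by
  have hηA (A : Fin n) : ContDiff ℝ ∞ fun s => η s A := contDiff_pi.1 hη A
  have hint {f : ℝ → ℝ} (hf : ContDiff ℝ ∞ f) : IntervalIntegrable f volume a b :=
    hf.continuous.intervalIntegrable a b
  have hv (A : Fin n) (k : Fin (N + 1)) := contDiff_fderiv_jet_apply hF hq
    ((0 : ℝ), Pi.single k (Pi.single A (1 : ℝ)))
  have hvanish {c : ℝ} (hc : (jet n N η c).2 = 0) (A : Fin n) (k : Fin (N + 1)) :
      ∀ i < (k : ℕ), iteratedDeriv i (fun s => η s A) c = 0 := fun i hi => by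
    rw [iteratedDeriv_apply hη]
    exact congrFun (congrFun hc ⟨i, hi.trans k.2⟩) A
  have hleft (s : ℝ) : fderiv ℝ F (jet n N q s) (0, (jet n N η s).2) =
      ∑ A, ∑ k : Fin (N + 1),
        fderiv ℝ F (jet n N q s) ((0 : ℝ), Pi.single k (Pi.single A (1 : ℝ))) *
          iteratedDeriv k (fun s => η s A) s := by
    rw [eq_sum_smul_single]
    simp only [map_sum, map_smul, smul_eq_mul, iteratedDeriv_apply hη]
    simp only [jet, mul_comm]
  simp_rw [hleft, eulerLagrange, Finset.sum_mul]
  rw [intervalIntegral.integral_finsetSum fun A _ => hint (ContDiff.sum fun k _ =>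
      (hv A k).mul (contDiff_infty_iteratedDeriv (hηA A) k)),
    intervalIntegral.integral_finsetSum fun A _ => hint (ContDiff.sum fun k _ =>
      (contDiff_const.mul (contDiff_infty_iteratedDeriv (hv A k) k)).mul (hηA A))]
  refine Finset.sum_congr rfl fun A _ => ?_
  rw [intervalIntegral.integral_finsetSum fun k _ => hint
      ((hv A k).mul (contDiff_infty_iteratedDeriv (hηA A) k)),
    intervalIntegral.integral_finsetSum fun k _ => hint
      ((contDiff_const.mul (contDiff_infty_iteratedDeriv (hv A k) k)).mul (hηA A))]
  exact Finset.sum_congr rfl fun k _ => intervalIntegral_mul_iteratedDeriv (hv A k) (hηA A) a b k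
    (hvanish ha A k) (hvanish hb A k)

/-- The first variation of the action `∫ F(j(q))` in a direction `η` whose jets vanish at the
endpoints. -/
theorem hasDerivAt_action (hF : ContDiff ℝ ∞ F) (hq : ContDiff ℝ ∞ q)
    (hη : ContDiff ℝ ∞ η) {a b : ℝ} (ha : (jet n N η a).2 = 0) (hb : (jet n N η b).2 = 0) (l₀ : ℝ) :
    HasDerivAt (fun l : ℝ => ∫ s in a..b, F (jet n N (fun s => q s + l • η s) s))
      (∫ s in a..b, ∑ A, eulerLagrange F (fun s => q s + l₀ • η s) A s * η s A) l₀ := by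
  let J : ℝ × ℝ → ℝ × (Fin (N + 1) → Fin n → ℝ) :=
    fun p => jet n N q p.2 + p.1 • (0, (jet n N η p.2).2)
  have hJ : ContDiff ℝ ∞ J :=
    ((contDiff_jet hq).comp contDiff_snd).add (contDiff_fst.smul
      (contDiff_const.prodMk (((contDiff_jet hη).comp contDiff_snd).snd)))
  have hG : ContDiff ℝ ∞ fun p => F (J p) := hF.comp hJ
  have hderiv (s : ℝ) : fderiv ℝ (fun p => F (J p)) (l₀, s) (1, 0) =
      fderiv ℝ F (jet n N (fun s => q s + l₀ • η s) s) (0, (jet n N η s).2) := by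
    have h1 : HasDerivAt (fun l : ℝ => J (l, s)) (0, (jet n N η s).2) l₀ := by
      simpa [J] using ((hasDerivAt_id l₀).smul_const
        ((0 : ℝ), (jet n N η s).2)).const_add (jet n N q s)
    have h2 := (hF.differentiable (by simp) (J (l₀, s))).hasFDerivAt.comp_hasDerivAt l₀ h1
    have h3 := (hG.differentiable (by simp) (l₀, s)).hasFDerivAt.comp_hasDerivAt l₀
      ((hasDerivAt_id l₀).prodMk (hasDerivAt_const l₀ s))
    rw [jet_add_smul hq hη]
    exact h3.unique h2
  have hcont : Continuous fun s => (fderiv ℝ (fun p => F (J p)) (l₀, s)).comp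
      (ContinuousLinearMap.inl ℝ ℝ ℝ) :=
    ((hG.continuous_fderiv (by simp)).comp (Continuous.prodMk_right l₀)).clm_comp
      continuous_const
  have key := (hasFDerivAt_intervalIntegral_of_contDiff (hG.of_le (by simp)) a b l₀).hasDerivAt
  rw [ContinuousLinearMap.intervalIntegral_apply (hcont.intervalIntegrable a b)] at key
  simp only [ContinuousLinearMap.comp_apply, ContinuousLinearMap.inl_apply, hderiv] at key
  rw [intervalIntegral_fderiv_jet hF (contDiff_add_smul hq hη l₀) hη ha hb] at key
  simpa only [J, ← jet_add_smul hq hη] using key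

/-- If the Euler–Lagrange derivative vanishes, the action depends only on the endpoint jets. -/
theorem action_eq_of_jet_eq (hF : ContDiff ℝ ∞ F)
    (hEL : ∀ q : ℝ → Fin n → ℝ, ContDiff ℝ ∞ q → ∀ A t, eulerLagrange F q A t = 0)
    {q₁ q₂ : ℝ → Fin n → ℝ} (h₁ : ContDiff ℝ ∞ q₁) (h₂ : ContDiff ℝ ∞ q₂) {a b : ℝ}
    (ha : jet n N q₁ a = jet n N q₂ a) (hb : jet n N q₁ b = jet n N q₂ b) :
    ∫ s in a..b, F (jet n N q₁ s) = ∫ s in a..b, F (jet n N q₂ s) := by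
  have hη : ContDiff ℝ ∞ fun s => q₂ s - q₁ s := h₂.sub h₁
  have hjet (c : ℝ) (hc : jet n N q₁ c = jet n N q₂ c) :
      (jet n N (fun s => q₂ s - q₁ s) c).2 = 0 := by
    have h := jet_add_smul (N := N) h₁ hη 1 c
    simp only [one_smul, add_sub_cancel] at h
    change jet n N q₂ c = _ at h
    rw [← hc] at h
    exact congrArg Prod.snd (left_eq_add.1 h)
  have hconst (l : ℝ) := hasDerivAt_action hF h₁ hη (hjet a ha) (hjet b hb) l
  simp only [hEL _ (contDiff_add_smul h₁ hη _), zero_mul, Finset.sum_const_zero,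
    intervalIntegral.integral_zero] at hconst
  have := is_const_of_deriv_eq_zero (fun l => (hconst l).differentiableAt)
    (fun l => (hconst l).deriv) 0 1
  simpa using this

theorem eulerLagrange_eq_zero_of_total_derivative (hF : ContDiff ℝ ∞ F)
    {K : ℝ × (Fin (N + 1) → Fin n → ℝ) → ℝ} (hK : ContDiff ℝ ∞ K)
    (hFK : ∀ q : ℝ → Fin n → ℝ, ContDiff ℝ ∞ q → ∀ t,
      F (jet n N q t) = deriv (fun s => K (jet n N q s)) t)
    (hq : ContDiff ℝ ∞ q) (A : Fin n) (t : ℝ) : eulerLagrange F q A t = 0 := by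
  have hE := contDiff_eulerLagrange hF hq A
  suffices h : ∀ᵐ s, eulerLagrange F q A s = 0 from
    congrFun ((Continuous.ae_eq_iff_eq volume hE.continuous
      (continuous_const (y := (0 : ℝ)))).1 h) t
  refine ae_eq_zero_of_integral_contDiff_smul_eq_zero hE.continuous.locallyIntegrable
    fun g hg hgs => ?_
  obtain ⟨R, hR⟩ := hgs.isCompact.isBounded.subset_closedBall 0
  rw [Real.closedBall_eq_Icc, zero_sub, zero_add] at hR
  let η : ℝ → Fin n → ℝ := fun s => g s • Pi.single A (1 : ℝ)
  have hη : ContDiff ℝ ∞ η := hg.smul contDiff_const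
  have hend {c : ℝ} (hc : c ∉ Icc (-R) R) : (jet n N η c).2 = 0 := by
    have h0 : η =ᶠ[𝓝 c] 0 := by
      filter_upwards [notMem_tsupport_iff_eventuallyEq.1 fun h => hc (hR h)] with s hs
      simp [η, hs]
    rw [jet_congr_of_eventuallyEq h0, jet_zero]
  have ha : (jet n N η (-R - 1)).2 = 0 := hend fun h => by linarith [h.1]
  have hb : (jet n N η (R + 1)).2 = 0 := hend fun h => by linarith [h.2]
  have hend' {c : ℝ} (hc : (jet n N η c).2 = 0) (l : ℝ) :
      jet n N (fun s => q s + l • η s) c = jet n N q c := by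
    rw [jet_add_smul hq hη, hc]
    simp
  have hconst (l : ℝ) : ∫ s in (-R - 1)..(R + 1), F (jet n N (fun s => q s + l • η s) s) =
      K (jet n N q (R + 1)) - K (jet n N q (-R - 1)) := by
    have hql := contDiff_add_smul hq hη l
    have hKj : ContDiff ℝ ∞ fun s => K (jet n N (fun s => q s + l • η s) s) :=
      hK.comp (contDiff_jet hql)
    simp only [hFK _ hql]
    rw [intervalIntegral.integral_deriv_eq_sub (fun s _ => hKj.differentiable (by simp) s)
      ((contDiff_infty_iff_deriv.1 hKj).2.continuous.intervalIntegrable _ _),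
      hend' ha, hend' hb]
  have hvar := hasDerivAt_action hF hq hη ha hb 0
  simp only [hconst] at hvar
  have h0 := (hasDerivAt_const (0 : ℝ) _).unique hvar
  have hsum (s : ℝ) : ∑ B, eulerLagrange F (fun s => q s + (0 : ℝ) • η s) B s * η s B =
      g s • eulerLagrange F q A s := by
    rw [Finset.sum_eq_single A (fun B _ hB => by simp [η, hB]) (by simp)]
    simp [η, mul_comm]
  simp only [hsum] at h0
  rw [h0, intervalIntegral.integral_eq_integral_of_support_subset]
  intro s hs
  have : g s ≠ 0 := fun h => hs (by simp [h])
  have := hR (subset_tsupport g this)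
  exact ⟨by linarith [this.1], by linarith [this.2]⟩

end Jet

section Primitive

/-- A smooth function that is `x ^ k / k!` for `-1 ≤ x` and vanishes for `x ≤ -2`. -/
noncomputable def truncatedMonomial (k : ℕ) (x : ℝ) : ℝ :=
  Real.smoothTransition (x + 2) * (x ^ k / k.factorial)

theorem contDiff_truncatedMonomial (k : ℕ) : ContDiff ℝ ∞ (truncatedMonomial k) :=
  (Real.smoothTransition.contDiff.comp (contDiff_id.add contDiff_const)).mul
    ((contDiff_id.pow k).div_const _)

theorem truncatedMonomial_of_le (k : ℕ) {x : ℝ} (hx : x ≤ -2) : truncatedMonomial k x = 0 := by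
  rw [truncatedMonomial, Real.smoothTransition.zero_of_nonpos (by linarith), zero_mul]

theorem truncatedMonomial_of_ge (k : ℕ) {x : ℝ} (hx : -1 ≤ x) :
    truncatedMonomial k x = x ^ k / k.factorial := by
  rw [truncatedMonomial, Real.smoothTransition.one_of_one_le (by linarith), one_mul]

theorem iteratedDeriv_truncatedMonomial_zero (i k : ℕ) :
    iteratedDeriv i (truncatedMonomial k) 0 = if i = k then 1 else 0 := by
  have h : truncatedMonomial k =ᶠ[𝓝 0] fun x => x ^ k / k.factorial := by
    filter_upwards [lt_mem_nhds (show (-1 : ℝ) < 0 by norm_num)] with x hx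
    exact truncatedMonomial_of_ge k hx.le
  rw [(h.iteratedDeriv i).eq_of_nhds, iteratedDeriv_div_const, iteratedDeriv_fun_pow_zero]
  split_ifs with hik
  · subst hik
    exact div_self (by exact_mod_cast i.factorial_ne_zero)
  · simp

variable {n N : ℕ}

/-- A smooth curve with jet `p` at time `t` that vanishes before time `t - 2`. -/
noncomputable def truncatedTaylor (t : ℝ) (p : Fin (N + 1) → Fin n → ℝ) (s : ℝ) : Fin n → ℝ :=
  ∑ k : Fin (N + 1), truncatedMonomial k (s - t) • p k

theorem contDiff_truncatedTaylor (t : ℝ) (p : Fin (N + 1) → Fin n → ℝ) :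
    ContDiff ℝ ∞ (truncatedTaylor t p) :=
  ContDiff.sum fun k _ => ((contDiff_truncatedMonomial k).comp
    (contDiff_id.sub contDiff_const)).smul contDiff_const

theorem jet_truncatedTaylor (t : ℝ) (p : Fin (N + 1) → Fin n → ℝ) (s : ℝ) :
    jet n N (truncatedTaylor t p) s =
      (s, fun i : Fin (N + 1) => ∑ k : Fin (N + 1),
        iteratedDeriv i (truncatedMonomial k) (s - t) • p k) := by
  have hφ (k : Fin (N + 1)) : ContDiff ℝ ∞ fun s => truncatedMonomial k (s - t) :=
    (contDiff_truncatedMonomial k).comp (contDiff_id.sub contDiff_const)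
  have hterm (k : Fin (N + 1)) : ContDiff ℝ ∞ fun s => truncatedMonomial k (s - t) • p k :=
    (hφ k).smul contDiff_const
  refine Prod.ext rfl (funext fun i => ?_)
  change iteratedDeriv i (fun s => ∑ k : Fin (N + 1), truncatedMonomial k (s - t) • p k) s = _
  rw [iteratedDeriv_fun_sum fun k _ => (contDiff_infty.1 (hterm k) i).contDiffAt]
  refine Finset.sum_congr rfl fun k _ => ?_
  rw [iteratedDeriv_smul_const (contDiff_infty.1 (hφ k) i).contDiffAt,
    iteratedDeriv_comp_sub_const]

theorem jet_truncatedTaylor_self (t : ℝ) (p : Fin (N + 1) → Fin n → ℝ) :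
    jet n N (truncatedTaylor t p) t = (t, p) := by
  rw [jet_truncatedTaylor]
  refine Prod.ext rfl (funext fun i => ?_)
  simp [iteratedDeriv_truncatedMonomial_zero, Fin.val_inj]

theorem jet_truncatedTaylor_of_lt {t s : ℝ} (p : Fin (N + 1) → Fin n → ℝ) (hs : s < t - 2) :
    jet n N (truncatedTaylor t p) s = (s, 0) := by
  have h : truncatedTaylor t p =ᶠ[𝓝 s] 0 := by
    filter_upwards [gt_mem_nhds hs] with x hx
    exact Finset.sum_eq_zero fun k _ => by
      rw [truncatedMonomial_of_le k (by linarith), zero_smul]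
  rw [jet_congr_of_eventuallyEq h, jet_zero]

/-- The action of the truncated Taylor curve with jet `p` at time `t`, normalised to be computed
from time `0`. -/
noncomputable def actionPrimitive (F : ℝ × (Fin (N + 1) → Fin n → ℝ) → ℝ)
    (x : ℝ × (Fin (N + 1) → Fin n → ℝ)) : ℝ :=
  (∫ s in (0 : ℝ)..(x.1 - 2), F (s, 0)) +
    ∫ u in (-2 : ℝ)..0, F (x.1 + u, fun i => ∑ k : Fin (N + 1),
      iteratedDeriv i (truncatedMonomial k) u • x.2 k)

variable {F : ℝ × (Fin (N + 1) → Fin n → ℝ) → ℝ}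

theorem contDiff_actionPrimitive (hF : ContDiff ℝ ∞ F) : ContDiff ℝ ∞ (actionPrimitive F) := by
  have hF0 : ContDiff ℝ ∞ fun s : ℝ => F (s, 0) := hF.comp (contDiff_id.prodMk contDiff_const)
  have hP (x : ℝ) : HasDerivAt (fun x => ∫ s in (0 : ℝ)..x, F (s, 0)) (F (x, 0)) x :=
    hF0.continuous.integral_hasStrictDerivAt 0 x |>.hasDerivAt
  have hP' : ContDiff ℝ ∞ fun x => ∫ s in (0 : ℝ)..x, F (s, 0) :=
    contDiff_infty_iff_deriv.2 ⟨fun x => (hP x).differentiableAt, by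
      rw [funext fun x => (hP x).deriv]
      exact hF0⟩
  refine (hP'.comp (contDiff_fst.sub contDiff_const)).add ?_
  refine contDiff_infty_intervalIntegral (G := fun z : (ℝ × (Fin (N + 1) → Fin n → ℝ)) × ℝ =>
    F (z.1.1 + z.2, fun i => ∑ k : Fin (N + 1),
      iteratedDeriv i (truncatedMonomial k) z.2 • z.1.2 k)) _ _ (hF.comp ?_)
  refine (contDiff_fst.fst.add contDiff_snd).prodMk (contDiff_pi.2 fun i => ContDiff.sum fun k _ =>
    ((contDiff_infty_iteratedDeriv (contDiff_truncatedMonomial k) i).comp contDiff_snd).smul ?_)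
  exact contDiff_pi.1 contDiff_fst.snd k

theorem actionPrimitive_eq (hF : Continuous F) (t : ℝ) (p : Fin (N + 1) → Fin n → ℝ)
    {a : ℝ} (ha : a ≤ t - 2) :
    actionPrimitive F (t, p) = (∫ s in (0 : ℝ)..a, F (s, 0)) +
      ∫ s in a..t, F (jet n N (truncatedTaylor t p) s) := by
  have hint (q : ℝ → Fin n → ℝ) (hq : ContDiff ℝ ∞ q) (b c : ℝ) :
      IntervalIntegrable (fun s => F (jet n N q s)) volume b c :=
    (hF.comp (contDiff_jet hq).continuous).intervalIntegrable b c
  have hint0 (b c : ℝ) : IntervalIntegrable (fun s : ℝ => F (s, 0)) volume b c :=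
    (hF.comp (Continuous.prodMk_left _)).intervalIntegrable b c
  have h1 : ∫ u in (-2 : ℝ)..0, F (t + u, fun i => ∑ k : Fin (N + 1),
      iteratedDeriv i (truncatedMonomial k) u • p k) =
      ∫ s in (t - 2)..t, F (jet n N (truncatedTaylor t p) s) := by
    have := intervalIntegral.integral_comp_add_left (a := -2) (b := 0)
      (fun s => F (jet n N (truncatedTaylor t p) s)) t
    simpa [jet_truncatedTaylor, sub_eq_add_neg] using this
  have h2 : ∫ s in a..(t - 2), F (s, 0) =
      ∫ s in a..(t - 2), F (jet n N (truncatedTaylor t p) s) := by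
    refine intervalIntegral.integral_congr_ae ?_
    filter_upwards [compl_mem_ae_iff.2 (measure_singleton (t - 2))] with s hs hsI
    rw [uIoc_of_le ha] at hsI
    rw [jet_truncatedTaylor_of_lt p (lt_of_le_of_ne hsI.2 hs)]
  have hc := contDiff_truncatedTaylor t p
  rw [actionPrimitive, h1, ← intervalIntegral.integral_add_adjacent_intervals
      (hint0 0 a) (hint0 a (t - 2)), h2, add_assoc,
    intervalIntegral.integral_add_adjacent_intervals (hint _ hc _ _) (hint _ hc _ _)]

theorem hasDerivAt_actionPrimitive (hF : ContDiff ℝ ∞ F)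
    (hEL : ∀ q : ℝ → Fin n → ℝ, ContDiff ℝ ∞ q → ∀ A t, eulerLagrange F q A t = 0)
    {q : ℝ → Fin n → ℝ} (hq : ContDiff ℝ ∞ q) (t : ℝ) :
    HasDerivAt (fun s => actionPrimitive F (jet n N q s)) (F (jet n N q t)) t := by
  let q' : ℝ → Fin n → ℝ := fun s => truncatedMonomial 0 (s - t) • q s
  have hq' : ContDiff ℝ ∞ q' :=
    ((contDiff_truncatedMonomial 0).comp (contDiff_id.sub contDiff_const)).smul hq
  have hright {s : ℝ} (hs : t - 1 < s) : jet n N q' s = jet n N q s := by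
    refine jet_congr_of_eventuallyEq ?_
    filter_upwards [lt_mem_nhds hs] with x hx
    simp [q', truncatedMonomial_of_ge 0 (show -1 ≤ x - t by linarith)]
  have hleft : jet n N q' (t - 4) = (t - 4, 0) := by
    have h : q' =ᶠ[𝓝 (t - 4)] 0 := by
      filter_upwards [gt_mem_nhds (show t - 4 < t - 2 by linarith)] with x hx
      simp [q', truncatedMonomial_of_le 0 (show x - t ≤ -2 by linarith)]
    rw [jet_congr_of_eventuallyEq h, jet_zero]
  have hcont : Continuous fun s => F (jet n N q' s) :=
    hF.continuous.comp (contDiff_jet hq').continuous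
  have hderiv := (hcont.integral_hasStrictDerivAt (t - 4) t).hasDerivAt.const_add
    (∫ s in (0 : ℝ)..(t - 4), F (s, 0))
  rw [hright (by linarith)] at hderiv
  refine hderiv.congr_of_eventuallyEq ?_
  filter_upwards [lt_mem_nhds (show t - 1 < t by linarith)] with s hs
  have hjet : jet n N q s = (s, (jet n N q s).2) := rfl
  rw [hjet, actionPrimitive_eq hF.continuous s _ (show t - 4 ≤ s - 2 by linarith),
    action_eq_of_jet_eq hF hEL (contDiff_truncatedTaylor s _) hq'
      (by rw [hleft, jet_truncatedTaylor_of_lt _ (by linarith)])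
      (by rw [hright hs, jet_truncatedTaylor_self, ← hjet])]

end Primitive

/-- A smooth function `F` on the jet space has identically vanishing Euler–Lagrange
derivative along all smooth curves if and only if it is a total time derivative of a
smooth function `K` on the jet space. -/
theorem eulerLagrange_vanishes_iff_total_derivative (n N : ℕ) (hn : 1 ≤ n)
    (F : ℝ × (Fin (N + 1) → Fin n → ℝ) → ℝ) (hF : ContDiff ℝ (⊤ : ℕ∞) F) :
    (∀ q : ℝ → Fin n → ℝ, ContDiff ℝ (⊤ : ℕ∞) q → ∀ (t : ℝ) (A : Fin n),
        ∑ k : Fin (N + 1), (-1 : ℝ) ^ (k : ℕ) *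
          iteratedDeriv (k : ℕ)
            (fun s => fderiv ℝ F (jet n N q s)
              ((0 : ℝ), Pi.single k (Pi.single A (1 : ℝ)))) t = 0)
    ↔ (∃ K : ℝ × (Fin (N + 1) → Fin n → ℝ) → ℝ, ContDiff ℝ (⊤ : ℕ∞) K ∧
        ∀ q : ℝ → Fin n → ℝ, ContDiff ℝ (⊤ : ℕ∞) q → ∀ t : ℝ,
          F (jet n N q t) = deriv (fun s => K (jet n N q s)) t) := by
  refine ⟨fun hEL => ⟨actionPrimitive F, contDiff_actionPrimitive hF, fun q hq t => ?_⟩, ?_⟩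
  · exact (hasDerivAt_actionPrimitive hF (fun q hq A t => hEL q hq t A) hq t).deriv.symm
  · rintro ⟨K, hK, hFK⟩ q hq t A
    exact eulerLagrange_eq_zero_of_total_derivative hF hK hFK hq A t
end

section
/- Let H : ℝ²ⁿ × ℝ → ℝ be smooth, t₀ ∈ ℝ, and let φ : ℝ × ℝ²ⁿ → ℝ²ⁿ be smooth with φ(t₀, x₀) = x₀ for all x₀ and ∂φ/∂t(t, x₀) = J · ∇ₓH(φ(t, x₀), t) for all (t, x₀) (Hamilton's equations generated by the possibly time-dependent Hamiltonian H). Then for every (t, x₀) the Jacobian matrix M(t, x₀) := D_{x₀}φ(t, x₀) satisfies M(t, x₀) · J · M(t, x₀)ᵀ = J. In particular, the Poisson bracket is independent of time: for all components M, N one has {φ^M(t,·), φ^N(t,·)}(x₀) = J^{MN}, i.e. the time evolution generated by the Hamiltonian is a symplectic transformation. -/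
open scoped BigOperators
open Matrix

/-- The phase space `ℝ²ⁿ`, with coordinates indexed by `Fin n ⊕ Fin n`
(positions `q^A = x (inl A)`, momenta `p_A = x (inr A)`). -/
abbrev Phase (n : ℕ) : Type := (Fin n ⊕ Fin n) → ℝ

/-- The standard symplectic matrix `J = [[0, 1], [-1, 0]]`. -/
noncomputable def stdJ (n : ℕ) : Matrix (Fin n ⊕ Fin n) (Fin n ⊕ Fin n) ℝ :=
  Matrix.fromBlocks 0 1 (-1) 0

/-- The Poisson bracket `{F, G} = Σ_A (∂F/∂q^A ∂G/∂p_A − ∂F/∂p_A ∂G/∂q^A)`. -/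
noncomputable def poissonBracket (n : ℕ) (F G : Phase n → ℝ) (x : Phase n) : ℝ :=
  ∑ A : Fin n,
    (fderiv ℝ F x (Pi.single (Sum.inl A) 1) * fderiv ℝ G x (Pi.single (Sum.inr A) 1)
      - fderiv ℝ F x (Pi.single (Sum.inr A) 1) * fderiv ℝ G x (Pi.single (Sum.inl A) 1))

/-- `stdJ` is the opposite of Mathlib's `Matrix.J`. -/
lemma stdJ_eq_neg_J (n : ℕ) : stdJ n = -Matrix.J (Fin n) ℝ := by
  simp [stdJ, Matrix.J, Matrix.fromBlocks_neg]

lemma stdJ_transpose (n : ℕ) : (stdJ n)ᵀ = -stdJ n := by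
  simp [stdJ_eq_neg_J, Matrix.J_transpose]

lemma stdJ_mul_stdJ (n : ℕ) : stdJ n * stdJ n = -1 := by
  simp [stdJ_eq_neg_J, Matrix.J_squared]

/-- `M` preserves `stdJ` as soon as `Mᵀ` does. -/
lemma mul_stdJ_mul_transpose {n : ℕ} {M : Matrix (Fin n ⊕ Fin n) (Fin n ⊕ Fin n) ℝ}
    (h : Mᵀ * stdJ n * M = stdJ n) : M * stdJ n * Mᵀ = stdJ n := by
  simp only [stdJ_eq_neg_J, Matrix.mul_neg, Matrix.neg_mul, neg_inj] at h ⊢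
  exact SymplecticGroup.mem_iff.mp (SymplecticGroup.mem_iff'.mpr h)

lemma poissonBracket_eq (n : ℕ) (F G : Phase n → ℝ) (x : Phase n) :
    poissonBracket n F G x = (fun i => fderiv ℝ F x (Pi.single i 1)) ⬝ᵥ
      (stdJ n *ᵥ fun i => fderiv ℝ G x (Pi.single i 1)) := by
  simp [poissonBracket, stdJ, dotProduct, Matrix.mulVec, Matrix.fromBlocks, Matrix.one_apply,
    sub_eq_add_neg, Finset.sum_add_distrib]

lemma HasDerivAt.dotProduct {ι : Type*} [Fintype ι] {u v : ℝ → ι → ℝ} {u' v' : ι → ℝ} {t : ℝ}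
    (hu : HasDerivAt u u' t) (hv : HasDerivAt v v' t) :
    HasDerivAt (fun s => u s ⬝ᵥ v s) (u' ⬝ᵥ v t + u t ⬝ᵥ v') t := by
  simp only [_root_.dotProduct, ← Finset.sum_add_distrib]
  exact HasDerivAt.fun_sum fun i _ =>
    (hasDerivAt_pi.mp hu i).mul (hasDerivAt_pi.mp hv i)

lemma HasDerivAt.mulVec {ι κ : Type*} [Fintype ι] [Fintype κ] (A : Matrix ι κ ℝ)
    {v : ℝ → κ → ℝ} {v' : κ → ℝ} {t : ℝ} (hv : HasDerivAt v v' t) :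
    HasDerivAt (fun s => A *ᵥ v s) (A *ᵥ v') t :=
  (Matrix.mulVecLin A).toContinuousLinearMap.hasFDerivAt.comp_hasDerivAt t hv

/-- The symplectic form is constant along solutions of an infinitesimally symplectic
linear system: `U' = J a`, `V' = J b` with `a ⬝ V = U ⬝ b`. -/
lemma hasDerivAt_dotProduct_stdJ_mulVec {n : ℕ} {U V : ℝ → Phase n} {a b : Phase n} {t : ℝ}
    (hU : HasDerivAt U (stdJ n *ᵥ a) t) (hV : HasDerivAt V (stdJ n *ᵥ b) t)
    (hab : a ⬝ᵥ V t = U t ⬝ᵥ b) :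
    HasDerivAt (fun s => U s ⬝ᵥ (stdJ n *ᵥ V s)) 0 t := by
  convert hU.dotProduct (hV.mulVec (stdJ n)) using 1
  have h : (stdJ n *ᵥ a) ⬝ᵥ (stdJ n *ᵥ V t) = a ⬝ᵥ V t := by
    rw [Matrix.dotProduct_mulVec, ← Matrix.mulVec_transpose, stdJ_transpose, Matrix.mulVec_mulVec,
      Matrix.neg_mul, stdJ_mul_stdJ, neg_neg, Matrix.one_mulVec]
  rw [h, Matrix.mulVec_mulVec, stdJ_mul_stdJ, Matrix.neg_mulVec, Matrix.one_mulVec,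
    dotProduct_neg, hab, add_neg_cancel]

/-- A linear functional on `ι → ℝ` is the dot product with its values on the standard basis. -/
lemma dotProduct_apply_single {ι : Type*} [Fintype ι] [DecidableEq ι] (L : (ι → ℝ) →L[ℝ] ℝ)
    (v : ι → ℝ) : (fun j => L (Pi.single j 1)) ⬝ᵥ v = L v := by
  conv_rhs => rw [pi_eq_sum_univ' v, map_sum]
  simp [dotProduct, mul_comm, Pi.single]

section Partial

variable {E F G : Type*} [NormedAddCommGroup E] [NormedSpace ℝ E] [NormedAddCommGroup F]
  [NormedSpace ℝ F] [NormedAddCommGroup G] [NormedSpace ℝ G]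

lemma fderiv_partial_left {f : E × F → G} (hf : Differentiable ℝ f) (x : E) (y : F) (v : E) :
    fderiv ℝ (fun z => f (z, y)) x v = fderiv ℝ f (x, y) (v, 0) := by
  have h := HasFDerivAt.comp (g := f) (f := fun z => (z, y)) x (hf (x, y)).hasFDerivAt (hasFDerivAt_prodMk_left x y)
  exact congrArg (fun L => L v) h.fderiv

lemma fderiv_partial_right {f : E × F → G} (hf : Differentiable ℝ f) (x : E) (y : F) (v : F) :
    fderiv ℝ (fun z => f (x, z)) y v = fderiv ℝ f (x, y) (0, v) := by
  have h := HasFDerivAt.comp (g := f) y (hf (x, y)).hasFDerivAt (hasFDerivAt_prodMk_right x y)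
  exact congrArg (fun L => L v) h.fderiv

lemma hasDerivAt_partial_left {f : ℝ × F → G} (hf : Differentiable ℝ f) (t : ℝ) (y : F) :
    HasDerivAt (fun s => f (s, y)) (fderiv ℝ f (t, y) (1, 0)) t :=
  HasFDerivAt.comp_hasDerivAt (l := f) t (hf (t, y)).hasFDerivAt
    ((hasDerivAt_id t).prodMk (hasDerivAt_const t y))

end Partial

/-- The variational equation: if `∂φ/∂t = J ∇H(φ, t)`, then each directional derivative `U` of
`φ` in the initial condition solves `U' = J (Hess H) U`. -/
lemma hasDerivAt_fderiv_flow {n : ℕ} {H : Phase n × ℝ → ℝ} (hH : ContDiff ℝ 2 H)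
    {φ : ℝ × Phase n → Phase n} (hφ : ContDiff ℝ 2 φ)
    (hHam : ∀ z : ℝ × Phase n, fderiv ℝ φ z (1, 0)
      = stdJ n *ᵥ fun j => fderiv ℝ H (φ z, z.1) (Pi.single j 1, 0))
    (t : ℝ) (x₀ u : Phase n) :
    HasDerivAt (fun s => fderiv ℝ φ (s, x₀) (0, u))
      (stdJ n *ᵥ fun j => fderiv ℝ (fderiv ℝ H) (φ (t, x₀), t)
        (fderiv ℝ φ (t, x₀) (0, u), 0) (Pi.single j 1, 0)) t := by
  have hDφ : Differentiable ℝ (fderiv ℝ φ) :=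
    (hφ.fderiv_right (m := 1) (by norm_num)).differentiable one_ne_zero
  have hDH : Differentiable ℝ (fderiv ℝ H) :=
    (hH.fderiv_right (m := 1) (by norm_num)).differentiable one_ne_zero
  have hdφ : Differentiable ℝ φ := hφ.differentiable (by simp)
  have hsymm : IsSymmSndFDerivAt ℝ φ (t, x₀) :=
    hφ.contDiffAt.isSymmSndFDerivAt (by simp)
  have h1 := (hasDerivAt_partial_left hDφ t x₀).clm_apply (hasDerivAt_const t ((0 : ℝ), u))
  refine h1.congr_deriv ?_
  rw [map_zero, add_zero, hsymm.eq]
  have hc : HasDerivAt (fun s : ℝ => (t, x₀ + s • u)) ((0 : ℝ), u) 0 := by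
    refine (hasDerivAt_const _ _).prodMk ?_
    simpa using ((hasDerivAt_id (0 : ℝ)).smul_const u).const_add x₀
  have hx : (t, x₀) = (t, x₀ + (0 : ℝ) • u) := by simp
  have hl : HasDerivAt (fun s : ℝ => fderiv ℝ φ (t, x₀ + s • u) (1, 0))
      (fderiv ℝ (fderiv ℝ φ) (t, x₀) (0, u) (1, 0)) 0 := by
    have h2 := (HasFDerivAt.comp_hasDerivAt_of_eq (0 : ℝ) (hDφ (t, x₀)).hasFDerivAt hc
      hx).clm_apply (hasDerivAt_const (0 : ℝ) ((1 : ℝ), (0 : Phase n)))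
    rwa [map_zero, add_zero] at h2
  have hp : HasDerivAt (fun s : ℝ => (φ (t, x₀ + s • u), t))
      (fderiv ℝ φ (t, x₀) (0, u), (0 : ℝ)) 0 :=
    (HasFDerivAt.comp_hasDerivAt_of_eq (0 : ℝ) (hdφ (t, x₀)).hasFDerivAt hc hx).prodMk
      (hasDerivAt_const _ _)
  have hr : HasDerivAt (fun s : ℝ => fderiv ℝ φ (t, x₀ + s • u) (1, 0))
      (stdJ n *ᵥ fun j => fderiv ℝ (fderiv ℝ H) (φ (t, x₀), t)
        (fderiv ℝ φ (t, x₀) (0, u), 0) (Pi.single j 1, 0)) 0 := by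
    simp only [hHam]
    refine HasDerivAt.mulVec _ (hasDerivAt_pi.mpr fun j => ?_)
    have h2 := (HasFDerivAt.comp_hasDerivAt_of_eq (0 : ℝ) (hDH (φ (t, x₀), t)).hasFDerivAt hp
      (by rw [← hx])).clm_apply (hasDerivAt_const (0 : ℝ) ((Pi.single j 1 : Phase n), (0 : ℝ)))
    rwa [map_zero, add_zero] at h2
  exact hl.unique hr

/-- Along a Hamiltonian flow, the symplectic product of two variations of the initial condition
does not depend on time. -/
lemma dotProduct_stdJ_mulVec_fderiv_flow {n : ℕ} {H : Phase n × ℝ → ℝ}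
    (hH : ContDiff ℝ 2 H) {φ : ℝ × Phase n → Phase n} (hφ : ContDiff ℝ 2 φ)
    (hHam : ∀ z : ℝ × Phase n, fderiv ℝ φ z (1, 0)
      = stdJ n *ᵥ fun j => fderiv ℝ H (φ z, z.1) (Pi.single j 1, 0))
    (t t₀ : ℝ) (x₀ u v : Phase n) :
    fderiv ℝ φ (t, x₀) (0, u) ⬝ᵥ (stdJ n *ᵥ fderiv ℝ φ (t, x₀) (0, v))
      = fderiv ℝ φ (t₀, x₀) (0, u) ⬝ᵥ (stdJ n *ᵥ fderiv ℝ φ (t₀, x₀) (0, v)) := by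
  have key : ∀ s, HasDerivAt (fun s => fderiv ℝ φ (s, x₀) (0, u) ⬝ᵥ
      (stdJ n *ᵥ fderiv ℝ φ (s, x₀) (0, v))) 0 s := fun s => by
    refine hasDerivAt_dotProduct_stdJ_mulVec (hasDerivAt_fderiv_flow hH hφ hHam s x₀ u)
      (hasDerivAt_fderiv_flow hH hφ hHam s x₀ v) ?_
    have hsymm : IsSymmSndFDerivAt ℝ H (φ (s, x₀), s) :=
      hH.contDiffAt.isSymmSndFDerivAt (by simp)
    have hB := fun a b : Phase n => dotProduct_apply_single
      ((fderiv ℝ (fderiv ℝ H) (φ (s, x₀), s) (a, 0)).comp (ContinuousLinearMap.inl ℝ _ ℝ)) b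
    simp only [ContinuousLinearMap.comp_apply, ContinuousLinearMap.inl_apply] at hB
    rw [dotProduct_comm (fderiv ℝ φ (s, x₀) (0, u)), hB, hB]
    exact hsymm.eq _ _
  exact is_const_of_deriv_eq_zero (fun s => (key s).differentiableAt) (fun s => (key s).deriv) t t₀

/-- The time evolution generated by a (possibly time-dependent) Hamiltonian is a
symplectic transformation: the Jacobian `M` of the flow satisfies `M J Mᵀ = J`, and in
particular the Poisson brackets of the components of the flow are time independent. -/
theorem hamiltonian_flow_symplectic (n : ℕ)
    (H : Phase n × ℝ → ℝ) (hH : ContDiff ℝ (⊤ : ℕ∞) H)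
    (t₀ : ℝ)
    (φ : ℝ × Phase n → Phase n) (hφ : ContDiff ℝ (⊤ : ℕ∞) φ)
    (hinit : ∀ x₀ : Phase n, φ (t₀, x₀) = x₀)
    (hHam : ∀ (t : ℝ) (x₀ : Phase n) (i : Fin n ⊕ Fin n),
      deriv (fun s => φ (s, x₀) i) t
        = ∑ j, stdJ n i j * fderiv ℝ (fun y => H (y, t)) (φ (t, x₀)) (Pi.single j 1)) :
    ∀ (t : ℝ) (x₀ : Phase n),
      (Matrix.of fun i j => fderiv ℝ (fun x => φ (t, x) i) x₀ (Pi.single j 1))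
          * stdJ n
          * (Matrix.of fun i j => fderiv ℝ (fun x => φ (t, x) i) x₀ (Pi.single j 1))ᵀ
        = stdJ n
      ∧ ∀ M N : Fin n ⊕ Fin n,
          poissonBracket n (fun x => φ (t, x) M) (fun x => φ (t, x) N) x₀ = stdJ n M N := by
  have hdφ : Differentiable ℝ φ := hφ.differentiable (by simp)
  have hdH : Differentiable ℝ H := hH.differentiable (by simp)
  have hHam' : ∀ z : ℝ × Phase n, fderiv ℝ φ z (1, 0)
      = stdJ n *ᵥ fun j => fderiv ℝ H (φ z, z.1) (Pi.single j 1, 0) := by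
    rintro ⟨t, x₀⟩
    ext i
    have h := hHam t x₀ i
    rw [(hasDerivAt_pi.mp (hasDerivAt_partial_left hdφ t x₀) i).deriv] at h
    simp only [fderiv_partial_left hdH] at h
    exact h
  have hentry : ∀ t x₀ i u, fderiv ℝ (fun x => φ (t, x) i) x₀ u
      = fderiv ℝ φ (t, x₀) (0, u) i := fun t x₀ i u => by
    rw [← fderiv_partial_right hdφ, fderiv_apply (by fun_prop)]
    rfl
  have hzero : ∀ x₀ u, fderiv ℝ φ (t₀, x₀) (0, u) = u := fun x₀ u => by
    rw [← fderiv_partial_right hdφ]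
    simp [hinit]
  intro t x₀
  have hM : (Matrix.of fun i j => fderiv ℝ (fun x => φ (t, x) i) x₀ (Pi.single j 1))
      * stdJ n
      * (Matrix.of fun i j => fderiv ℝ (fun x => φ (t, x) i) x₀ (Pi.single j 1))ᵀ = stdJ n := by
    apply mul_stdJ_mul_transpose
    ext k l
    have h := dotProduct_stdJ_mulVec_fderiv_flow (contDiff_infty.mp hH 2) (contDiff_infty.mp hφ 2) hHam' t t₀ x₀ (Pi.single k 1)
      (Pi.single l 1)
    rw [hzero, hzero, single_one_dotProduct, Matrix.mulVec_single_one, Matrix.col_apply] at h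
    rw [← h, Matrix.mul_assoc]
    simp only [hentry]
    rfl
  refine ⟨hM, fun M N => ?_⟩
  rw [poissonBracket_eq, ← congrFun₂ hM M N, Matrix.mul_assoc]
  rfl
end

section
/- Suppose (δq, δK) is an off-shell infinitesimal symmetry of the smooth Lagrangian L : ℝⁿ × ℝⁿ × ℝ → ℝ. If the smooth curve q : ℝ → ℝⁿ solves the Euler–Lagrange equations of L, then the Noether charge Q(t) := Σ_{A=1}^n δq^A(q(t), q'(t), t) · (∂L/∂v^A)(q(t), q'(t), t) − δK(q(t), q'(t), t) is constant in t. -/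
open scoped BigOperators

/-- Configuration–velocity–time space `(q, v, t)`. -/
abbrev Conf (n : ℕ) : Type := (Fin n → ℝ) × (Fin n → ℝ) × ℝ

/-- Partial derivative `∂f/∂q^A`. -/
noncomputable def pdQ (n : ℕ) (f : Conf n → ℝ) (A : Fin n) (x : Conf n) : ℝ :=
  fderiv ℝ f x (Pi.single A (1 : ℝ), 0, 0)

/-- Partial derivative `∂f/∂v^A`. -/
noncomputable def pdV (n : ℕ) (f : Conf n → ℝ) (A : Fin n) (x : Conf n) : ℝ :=
  fderiv ℝ f x (0, Pi.single A (1 : ℝ), 0)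

/-- Partial derivative `∂f/∂t`. -/
noncomputable def pdT (n : ℕ) (f : Conf n → ℝ) (x : Conf n) : ℝ :=
  fderiv ℝ f x (0, 0, 1)

/-- The induced variation of the velocity,
`δv^A := Σ_B a^B ∂(δq^A)/∂v^B + Σ_B v^B ∂(δq^A)/∂q^B + ∂(δq^A)/∂t`. -/
noncomputable def deltaV (n : ℕ) (δq : Conf n → Fin n → ℝ) (A : Fin n)
    (q v a : Fin n → ℝ) (t : ℝ) : ℝ :=
  (∑ B, a B * pdV n (fun x => δq x A) B (q, v, t))
    + (∑ B, v B * pdQ n (fun x => δq x A) B (q, v, t))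
    + pdT n (fun x => δq x A) (q, v, t)

/-- `(δq, δK)` is an off-shell infinitesimal symmetry of `L`:
`Σ_A δq^A ∂L/∂q^A + Σ_A δv^A ∂L/∂v^A = Σ_B a^B ∂(δK)/∂v^B + Σ_B v^B ∂(δK)/∂q^B + ∂(δK)/∂t`
for all `(q, v, a, t)`. -/
def IsOffShellSymmetry (n : ℕ) (L : Conf n → ℝ) (δq : Conf n → Fin n → ℝ)
    (δK : Conf n → ℝ) : Prop :=
  ∀ (q v a : Fin n → ℝ) (t : ℝ),
    (∑ A, δq (q, v, t) A * pdQ n L A (q, v, t))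
      + (∑ A, deltaV n δq A q v a t * pdV n L A (q, v, t))
    = (∑ B, a B * pdV n δK B (q, v, t))
      + (∑ B, v B * pdQ n δK B (q, v, t))
      + pdT n δK (q, v, t)

/-- The value of `fderiv` on a vector, expanded in the coordinates of `Conf n`. -/
theorem fderiv_conf_apply (n : ℕ) (f : Conf n → ℝ) (x : Conf n) (v a : Fin n → ℝ) :
    fderiv ℝ f x (v, a, 1)
      = (∑ B, a B * pdV n f B x) + (∑ B, v B * pdQ n f B x) + pdT n f x := by
  have hv : (v, a, (1 : ℝ)) = (∑ B, a B • ((0, Pi.single B 1, 0) : Conf n))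
      + (∑ B, v B • ((Pi.single B 1, 0, 0) : Conf n)) + (0, 0, 1) := by
    ext i <;>
      simp [Prod.fst_sum, Prod.snd_sum, Finset.sum_apply, Pi.single_apply]
  rw [hv, map_add, map_add, map_sum, map_sum]
  simp only [map_smul, smul_eq_mul, pdV, pdQ, pdT]

/-- The chain rule for a function on `Conf n` along the lift of a curve. -/
theorem hasDerivAt_comp_lift (n : ℕ) {f : Conf n → ℝ} (hf : Differentiable ℝ f)
    {q : ℝ → Fin n → ℝ} (hq : Differentiable ℝ q) (hq' : Differentiable ℝ (deriv q)) (t : ℝ) :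
    HasDerivAt (fun s => f (q s, deriv q s, s))
      ((∑ B, deriv (deriv q) t B * pdV n f B (q t, deriv q t, t))
        + (∑ B, deriv q t B * pdQ n f B (q t, deriv q t, t))
        + pdT n f (q t, deriv q t, t)) t := by
  rw [← fderiv_conf_apply]
  exact (hf _).hasFDerivAt.comp_hasDerivAt t
    ((hq t).hasDerivAt.prodMk ((hq' t).hasDerivAt.prodMk (hasDerivAt_id t)))

/-- If `(δq, δK)` is an off-shell infinitesimal symmetry of the smooth Lagrangian `L`,
then along any solution of the Euler–Lagrange equations the Noether charge
`Q(t) = Σ_A δq^A ∂L/∂v^A − δK` is constant in time. -/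
theorem noether_charge_conserved (n : ℕ)
    (L δK : Conf n → ℝ) (δq : Conf n → Fin n → ℝ)
    (hL : ContDiff ℝ (⊤ : ℕ∞) L) (hδK : ContDiff ℝ (⊤ : ℕ∞) δK)
    (hδq : ContDiff ℝ (⊤ : ℕ∞) δq)
    (hsym : IsOffShellSymmetry n L δq δK)
    (q : ℝ → Fin n → ℝ) (hq : ContDiff ℝ (⊤ : ℕ∞) q)
    (hEL : ∀ (t : ℝ) (A : Fin n),
      deriv (fun s => pdV n L A (q s, deriv q s, s)) t = pdQ n L A (q t, deriv q t, t)) :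
    ∀ t₁ t₂ : ℝ,
      ((∑ A, δq (q t₁, deriv q t₁, t₁) A * pdV n L A (q t₁, deriv q t₁, t₁))
          - δK (q t₁, deriv q t₁, t₁))
        = ((∑ A, δq (q t₂, deriv q t₂, t₂) A * pdV n L A (q t₂, deriv q t₂, t₂))
          - δK (q t₂, deriv q t₂, t₂)) := by
  have hqd : Differentiable ℝ q := hq.differentiable (by simp)
  have hqd' : Differentiable ℝ (deriv q) :=
    (contDiff_infty_iff_deriv.1 hq).2.differentiable (by simp)
  have hpV (A : Fin n) : Differentiable ℝ (pdV n L A) := by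
    have h : ContDiff ℝ (⊤ : ℕ∞) (fderiv ℝ L) :=
      hL.fderiv_right le_rfl
    exact (h.differentiable (by simp)).clm_apply (differentiable_const _)
  have hδqd (A : Fin n) : Differentiable ℝ (fun x => δq x A) :=
    differentiable_pi.1 (hδq.differentiable (by simp)) A
  have key (t : ℝ) : HasDerivAt (fun s => (∑ A, δq (q s, deriv q s, s) A *
      pdV n L A (q s, deriv q s, s)) - δK (q s, deriv q s, s)) 0 t := by
    have hp (A : Fin n) : HasDerivAt (fun s => pdV n L A (q s, deriv q s, s))
        (pdQ n L A (q t, deriv q t, t)) t := by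
      rw [← hEL t A]
      exact (hasDerivAt_comp_lift n (hpV A) hqd hqd' t).differentiableAt.hasDerivAt
    refine ((HasDerivAt.fun_sum fun A _ =>
      (hasDerivAt_comp_lift n (hδqd A) hqd hqd' t).mul (hp A)).sub
      (hasDerivAt_comp_lift n (hδK.differentiable (by simp)) hqd hqd' t)).congr_deriv ?_
    rw [← hsym (q t) (deriv q t) (deriv (deriv q) t) t, Finset.sum_add_distrib]
    simp only [deltaV]
    ring
  exact is_const_of_deriv_eq_zero (fun t => (key t).differentiableAt) fun t => (key t).deriv
end

section
/- Let L : ℝⁿ × ℝⁿ × ℝ → ℝ be a smooth Lagrangian and let Φ : ℝⁿ × ℝ → ℝⁿ be smooth such that the map (q, t) ↦ (Φ(q, t), t) is a diffeomorphism of ℝⁿ × ℝ. Assume there is a smooth K : ℝⁿ × ℝⁿ × ℝ → ℝ such that for every smooth curve q : ℝ → ℝⁿ and all t ∈ ℝ: L(Φ(q(t), t), (d/dt)[Φ(q(t), t)], t) = L(q(t), q'(t), t) + (d/dt)[K(q(t), q'(t), t)] (Φ is a symmetry of the action up to a total derivative). Then for every smooth curve q solving the Euler–Lagrange equations of L, the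 transformed curve t ↦ Φ(q(t), t) also solves the Euler–Lagrange equations of L. -/
open scoped BigOperators

/-- A curve `c : ℝ → ℝⁿ` solves the Euler–Lagrange equations of `L`:
`(d/dt)[∂L/∂v^A(c(t), c'(t), t)] = ∂L/∂q^A(c(t), c'(t), t)` for all `t` and `A`. -/
def IsELSolution (n : ℕ) (L : Conf n → ℝ) (c : ℝ → Fin n → ℝ) : Prop :=
  ∀ (t : ℝ) (A : Fin n),
    deriv (fun s => pdV n L A (c s, deriv c s, s)) t = pdQ n L A (c t, deriv c t, t)

open scoped ContDiff

section PartialDerivatives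

variable {E : Type*} [NormedAddCommGroup E] [NormedSpace ℝ E]

lemma hasDerivAt_fst_slice {f : ℝ × ℝ → E} {x : ℝ × ℝ} (hf : DifferentiableAt ℝ f x) :
    HasDerivAt (fun ε => f (ε, x.2)) (fderiv ℝ f x (1, 0)) x.1 :=
  hf.hasFDerivAt.comp_hasDerivAt (f := fun ε => (ε, x.2)) x.1
    ((hasDerivAt_id x.1).prodMk (hasDerivAt_const x.1 x.2))

lemma hasDerivAt_snd_slice {f : ℝ × ℝ → E} {x : ℝ × ℝ} (hf : DifferentiableAt ℝ f x) :
    HasDerivAt (fun s => f (x.1, s)) (fderiv ℝ f x (0, 1)) x.2 :=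
  hf.hasFDerivAt.comp_hasDerivAt (f := fun s => (x.1, s)) x.2
    ((hasDerivAt_const x.2 x.1).prodMk (hasDerivAt_id x.2))

lemma ContDiff.deriv_snd_slice {f : ℝ × ℝ → E} (hf : ContDiff ℝ ∞ f) :
    ContDiff ℝ ∞ (fun x : ℝ × ℝ => deriv (fun s => f (x.1, s)) x.2) := by
  have h : (fun x : ℝ × ℝ => deriv (fun s => f (x.1, s)) x.2) = fun x => fderiv ℝ f x (0, 1) :=
    funext fun x => (hasDerivAt_snd_slice (hf.differentiable (by simp) x)).deriv
  rw [h]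
  exact (hf.fderiv_right (m := ∞) (by simp)).clm_apply contDiff_const

/-- Symmetry of the mixed second partial derivatives of a smooth function on the plane. -/
lemma hasDerivAt_deriv_slice {f : ℝ × ℝ → E} (hf : ContDiff ℝ ∞ f) (ε t : ℝ) :
    HasDerivAt (fun ε => deriv (fun s => f (ε, s)) t)
      (deriv (fun s => deriv (fun ε => f (ε, s)) ε) t) ε := by
  have hd : Differentiable ℝ f := hf.differentiable (by simp)
  have hd' : Differentiable ℝ (fderiv ℝ f) :=
    (hf.fderiv_right (m := ∞) (by simp)).differentiable (by simp)
  have h₁ : (fun ε => deriv (fun s => f (ε, s)) t) = fun ε => fderiv ℝ f (ε, t) (0, 1) :=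
    funext fun ε => (hasDerivAt_snd_slice (x := (ε, t)) (hd _)).deriv
  have h₂ : (fun s => deriv (fun ε => f (ε, s)) ε) = fun s => fderiv ℝ f (ε, s) (1, 0) :=
    funext fun s => (hasDerivAt_fst_slice (x := (ε, s)) (hd _)).deriv
  have hsymm : IsSymmSndFDerivAt ℝ f (ε, t) :=
    hf.contDiffAt.isSymmSndFDerivAt (by
      rw [minSmoothness_of_isRCLikeNormedField]
      exact WithTop.coe_le_coe.2 le_top)
  have h₃ := (hasDerivAt_snd_slice (x := (ε, t)) (hd' _)).clm_apply
    (hasDerivAt_const t ((1, 0) : ℝ × ℝ))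
  have h₄ := (hasDerivAt_fst_slice (x := (ε, t)) (hd' _)).clm_apply
    (hasDerivAt_const ε ((0, 1) : ℝ × ℝ))
  rw [h₁, h₂, h₃.deriv]
  simp only [map_zero, add_zero] at h₄ ⊢
  rw [hsymm.eq (0, 1) (1, 0)]
  exact h₄

end PartialDerivatives

/-- The first variation of `F` along a smooth one-parameter family of curves. -/
lemma hasDerivAt_firstVariation {n : ℕ} {F : Conf n → ℝ} (hF : ContDiff ℝ ∞ F)
    {c : ℝ × ℝ → Fin n → ℝ} (hc : ContDiff ℝ ∞ c) (ε t : ℝ) :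
    HasDerivAt (fun ε => F (c (ε, t), deriv (fun s => c (ε, s)) t, t))
      (fderiv ℝ F (c (ε, t), deriv (fun s => c (ε, s)) t, t)
        (deriv (fun ε => c (ε, t)) ε, deriv (fun s => deriv (fun ε => c (ε, s)) ε) t, 0)) ε := by
  have hc₁ := (hasDerivAt_fst_slice (x := (ε, t)) (hc.differentiable (by simp) _))
  have hF' := (hF.differentiable (by simp) (c (ε, t), deriv (fun s => c (ε, s)) t, t)).hasFDerivAt
  exact hF'.comp_hasDerivAt
    (f := fun ε => (c (ε, t), deriv (fun s => c (ε, s)) t, t)) ε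
    (hc₁.differentiableAt.hasDerivAt.prodMk
      ((hasDerivAt_deriv_slice hc ε t).prodMk (hasDerivAt_const ε t)))

lemma fderiv_apply_eq_sum {n : ℕ} (F : Conf n → ℝ) (x : Conf n) (u w : Fin n → ℝ) :
    fderiv ℝ F x (u, w, 0) = ∑ B, (pdQ n F B x * u B + pdV n F B x * w B) := by
  have h : ((u, w, 0) : Conf n) = ∑ B, (u B • ((Pi.single B (1 : ℝ), 0, 0) : Conf n)
      + w B • ((0, Pi.single B (1 : ℝ), 0) : Conf n)) := by
    have hs (z : Fin n → ℝ) : z = ∑ B, z B • (Pi.single B (1 : ℝ) : Fin n → ℝ) :=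
      pi_eq_sum_univ' z
    refine Prod.ext ?_ (Prod.ext ?_ ?_)
    · simpa [Prod.fst_sum] using hs u
    · simpa [Prod.fst_sum, Prod.snd_sum] using hs w
    · simp [Prod.snd_sum]
  rw [h, map_sum]
  refine Finset.sum_congr rfl fun B _ => ?_
  simp only [map_add, map_smul, smul_eq_mul, pdQ, pdV]
  ring

lemma contDiff_jet_s3 {n : ℕ} {c : ℝ → Fin n → ℝ} (hc : ContDiff ℝ ∞ c) :
    ContDiff ℝ ∞ (fun s => ((c s, deriv c s, s) : Conf n)) :=
  hc.prodMk ((contDiff_infty_iff_deriv.1 hc).2.prodMk contDiff_id)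

lemma contDiff_pdV {n : ℕ} {F : Conf n → ℝ} (hF : ContDiff ℝ ∞ F) (A : Fin n) :
    ContDiff ℝ ∞ (pdV n F A) :=
  (hF.fderiv_right (m := ∞) (by simp)).clm_apply contDiff_const

/-- Along a solution of the Euler–Lagrange equations the first variation of `L` is the total
derivative of the momentum paired with the variation. -/
lemma IsELSolution.fderiv_eq_deriv {n : ℕ} {L : Conf n → ℝ} (hL : ContDiff ℝ ∞ L)
    {c : ℝ → Fin n → ℝ} (hc : ContDiff ℝ ∞ c) (hEL : IsELSolution n L c)
    {ξ : ℝ → Fin n → ℝ} (hξ : Differentiable ℝ ξ) (t : ℝ) :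
    fderiv ℝ L (c t, deriv c t, t) (ξ t, deriv ξ t, 0)
      = deriv (fun s => ∑ B, pdV n L B (c s, deriv c s, s) * ξ s B) t := by
  have hp (B : Fin n) : DifferentiableAt ℝ (fun s => pdV n L B (c s, deriv c s, s)) t :=
    ((contDiff_pdV hL B).comp (contDiff_jet_s3 hc)).differentiable (by simp) t
  have h : HasDerivAt (fun s => ∑ B, pdV n L B (c s, deriv c s, s) * ξ s B)
      (∑ B, (pdQ n L B (c t, deriv c t, t) * ξ t B
        + pdV n L B (c t, deriv c t, t) * deriv ξ t B)) t := by
    refine HasDerivAt.fun_sum fun B _ => ?_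
    rw [← hEL t B]
    exact (hp B).hasDerivAt.mul (hasDerivAt_pi.1 (hξ t).hasDerivAt B)
  rw [h.deriv, fderiv_apply_eq_sum]

/-- If `φ Q + φ' P = (φ α + φ' β)'` for every smooth `φ`, then `P' = Q`. -/
lemma deriv_eq_of_forall_mul {P Q α β : ℝ → ℝ} (hα : Differentiable ℝ α)
    (hβ : Differentiable ℝ β)
    (h : ∀ φ : ℝ → ℝ, ContDiff ℝ ∞ φ → ∀ t,
      φ t * Q t + deriv φ t * P t = deriv (fun s => φ s * α s + deriv φ s * β s) t) :
    deriv P = Q := by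
  have hβ0 : β = 0 := by
    funext t
    have hd (s : ℝ) : HasDerivAt (fun s : ℝ => (s - t) ^ 2) (2 * (s - t)) s := by
      simpa using ((hasDerivAt_id s).sub_const t).fun_pow 2
    have h₁ := h (fun s => (s - t) ^ 2) (by fun_prop) t
    have h₂ : deriv (fun s : ℝ => (s - t) ^ 2) = fun s => 2 * (s - t) :=
      funext fun s => (hd s).deriv
    have h₃ : HasDerivAt (fun s : ℝ => 2 * (s - t)) 2 t := by
      simpa using ((hasDerivAt_id t).sub_const t).const_mul 2
    have h₄ := ((hd t).mul (hα t).hasDerivAt).add (h₃.mul (hβ t).hasDerivAt)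
    rw [h₂] at h₁
    have h₅ := h₁.trans h₄.deriv
    simp at h₅
    simpa using h₅
  subst hβ0
  have hPα : P = α := by
    funext t
    have hd (s : ℝ) : HasDerivAt (fun s : ℝ => s - t) 1 s := (hasDerivAt_id s).sub_const t
    have h₁ := h (fun s => s - t) (by fun_prop) t
    simp only [Pi.zero_apply, mul_zero, add_zero] at h₁
    rw [(hd t).deriv, ((hd t).fun_mul (hα t).hasDerivAt).deriv] at h₁
    simpa using h₁
  funext t
  have h₁ := h (fun _ => 1) contDiff_const t
  simp at h₁
  rw [hPα]
  exact h₁.symm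

/-- A (finite, invertible) symmetry of the action up to a total derivative maps
solutions of the Euler–Lagrange equations to solutions. -/
theorem symmetry_maps_solutions_to_solutions (n : ℕ)
    (L : Conf n → ℝ) (hL : ContDiff ℝ (⊤ : ℕ∞) L)
    (Φ : (Fin n → ℝ) × ℝ → Fin n → ℝ) (hΦ : ContDiff ℝ (⊤ : ℕ∞) Φ)
    (Ψ : (Fin n → ℝ) × ℝ → Fin n → ℝ) (hΨ : ContDiff ℝ (⊤ : ℕ∞) Ψ)
    (hinv₁ : ∀ (q : Fin n → ℝ) (t : ℝ), Ψ (Φ (q, t), t) = q)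
    (hinv₂ : ∀ (q : Fin n → ℝ) (t : ℝ), Φ (Ψ (q, t), t) = q)
    (K : Conf n → ℝ) (hK : ContDiff ℝ (⊤ : ℕ∞) K)
    (hsym : ∀ q : ℝ → Fin n → ℝ, ContDiff ℝ (⊤ : ℕ∞) q → ∀ t : ℝ,
      L (Φ (q t, t), deriv (fun s => Φ (q s, s)) t, t)
        = L (q t, deriv q t, t) + deriv (fun s => K (q s, deriv q s, s)) t)
    (q : ℝ → Fin n → ℝ) (hq : ContDiff ℝ (⊤ : ℕ∞) q)
    (hEL : IsELSolution n L q) :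
    IsELSolution n L (fun t => Φ (q t, t)) := by
  intro t₀ A
  set r : ℝ → Fin n → ℝ := fun t => Φ (q t, t) with hr
  have hrs : ContDiff ℝ ∞ r := hΦ.comp (hq.prodMk contDiff_id)
  set e : Fin n → ℝ := Pi.single A 1 with he
  -- the variation of `q` induced by the constant variation `e` of `r`
  set m : ℝ → Fin n → ℝ := fun s => fderiv ℝ Ψ (r s, s) (e, 0) with hm
  have hms : ContDiff ℝ ∞ m :=
    ((hΨ.fderiv_right (m := ∞) (by simp)).comp (hrs.prodMk contDiff_id)).clm_apply contDiff_const
  have hms' : ContDiff ℝ ∞ (deriv m) := (contDiff_infty_iff_deriv.1 hms).2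
  have hKjet : ContDiff ℝ ∞ (fun s => fderiv ℝ K (q s, deriv q s, s)) :=
    (hK.fderiv_right (m := ∞) (by simp)).comp (contDiff_jet_s3 hq)
  set α : ℝ → ℝ := fun s => ∑ B, pdV n L B (q s, deriv q s, s) * m s B
    + fderiv ℝ K (q s, deriv q s, s) (m s, deriv m s, 0) with hα
  set β : ℝ → ℝ := fun s => fderiv ℝ K (q s, deriv q s, s) (0, m s, 0) with hβ
  have hpm : ContDiff ℝ ∞ (fun s => ∑ B, pdV n L B (q s, deriv q s, s) * m s B) :=
    ContDiff.sum fun B _ => ((contDiff_pdV hL B).comp (contDiff_jet_s3 hq)).mul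
      (contDiff_pi.1 hms B)
  have hαs : Differentiable ℝ α :=
    (hpm.add (hKjet.clm_apply (hms.prodMk (hms'.prodMk contDiff_const)))).differentiable (by simp)
  have hβs : Differentiable ℝ β :=
    (hKjet.clm_apply (contDiff_const.prodMk (hms.prodMk contDiff_const))).differentiable (by simp)
  refine congrFun (deriv_eq_of_forall_mul (P := fun s => pdV n L A (r s, deriv r s, s))
    (Q := fun s => pdQ n L A (r s, deriv r s, s)) hαs hβs fun φ hφ t => ?_) t₀
  set b : ℝ × ℝ → Fin n → ℝ := fun x => r x.2 + (x.1 * φ x.2) • e with hb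
  have hbs : ContDiff ℝ ∞ b :=
    (hrs.comp contDiff_snd).add
      ((contDiff_fst.mul (hφ.comp contDiff_snd)).smul contDiff_const)
  set c : ℝ × ℝ → Fin n → ℝ := fun x => Ψ (b x, x.2) with hc
  have hcs : ContDiff ℝ ∞ c := hΨ.comp (hbs.prodMk contDiff_snd)
  have hΦc (x : ℝ × ℝ) : Φ (c x, x.2) = b x := hinv₂ _ _
  have hb0 (s : ℝ) : b (0, s) = r s := by simp [hb]
  have hc0 (s : ℝ) : c (0, s) = q s := by simp only [hc, hb0, hr, hinv₁]
  have hbε (s : ℝ) : HasDerivAt (fun ε => b (ε, s)) (φ s • e) 0 := by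
    simpa [hb] using ((hasDerivAt_id (0 : ℝ)).mul_const (φ s)).smul_const e
  have hcε (s : ℝ) : HasDerivAt (fun ε => c (ε, s)) (φ s • m s) 0 := by
    have hΨd := (hΨ.differentiable (by simp) (b (0, s), s)).hasFDerivAt
    have h := hΨd.comp_hasDerivAt (f := fun ε => (b (ε, s), s)) 0
      ((hbε s).prodMk (hasDerivAt_const 0 s))
    rw [hb0] at h
    have h' : fderiv ℝ Ψ (r s, s) (φ s • e, 0) = φ s • m s := by
      rw [hm, ← map_smul, Prod.smul_mk, smul_zero]
    rwa [h'] at h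
  have hφd : Differentiable ℝ φ := hφ.differentiable (by simp)
  have hξd (s : ℝ) : HasDerivAt (fun s => φ s • m s) (φ s • deriv m s + deriv φ s • m s) s :=
    (hφd s).hasDerivAt.smul (hms.differentiable (by simp) s).hasDerivAt
  have hbd : deriv (fun s => φ s • e) t = deriv φ t • e :=
    ((hφd t).hasDerivAt.smul_const e).deriv
  have hvarL := hasDerivAt_firstVariation hL hcs 0 t
  have hvarb := hasDerivAt_firstVariation hL hbs 0 t
  set k : ℝ × ℝ → ℝ := fun x => K (c x, deriv (fun s => c (x.1, s)) x.2, x.2) with hk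
  have hks : ContDiff ℝ ∞ k := hK.comp (hcs.prodMk (hcs.deriv_snd_slice.prodMk contDiff_snd))
  have hvark := hasDerivAt_deriv_slice hks 0 t
  have hkε (s : ℝ) := (hasDerivAt_firstVariation hK hcs 0 s).deriv
  simp only [hb0, hc0, (hbε _).deriv, (hcε _).deriv, hbd] at hvarL hvarb hkε
  have hsym' : (fun ε => L (b (ε, t), deriv (fun s => b (ε, s)) t, t)) = fun ε =>
      L (c (ε, t), deriv (fun s => c (ε, s)) t, t) + deriv (fun s => k (ε, s)) t := by
    funext ε
    have h := hsym (fun s => c (ε, s)) (hcs.comp (contDiff_const.prodMk contDiff_id)) t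
    simpa only [fun s => hΦc (ε, s)] using h
  rw [hsym'] at hvarb
  have key := hvarb.unique (hvarL.add hvark)
  rw [hEL.fderiv_eq_deriv hL hq (fun s => (hξd s).differentiableAt)] at key
  have hlhs : fderiv ℝ L (r t, deriv r t, t) (φ t • e, deriv φ t • e, 0)
      = φ t * pdQ n L A (r t, deriv r t, t) + deriv φ t * pdV n L A (r t, deriv r t, t) := by
    have h : ((φ t • e, deriv φ t • e, 0) : Conf n)
        = φ t • ((e, 0, 0) : Conf n) + deriv φ t • ((0, e, 0) : Conf n) := by simp
    rw [h, map_add, map_smul, map_smul]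
    rfl
  have hkε' : (fun s => deriv (fun ε => k (ε, s)) 0) = fun s =>
      φ s * fderiv ℝ K (q s, deriv q s, s) (m s, deriv m s, 0) + deriv φ s * β s := by
    funext s
    have h : ((φ s • m s, φ s • deriv m s + deriv φ s • m s, 0) : Conf n)
        = φ s • ((m s, deriv m s, 0) : Conf n) + deriv φ s • ((0, m s, 0) : Conf n) := by simp
    refine (hkε s).trans ?_
    rw [(hξd s).deriv, h, map_add, map_smul, map_smul]
    rfl
  rw [← hlhs, key, hkε', ← deriv_fun_add]
  · congr 1
    funext s
    simp only [hα, Pi.smul_apply, smul_eq_mul, mul_add, Finset.mul_sum, ← add_assoc,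
      mul_left_comm]
  · exact (ContDiff.sum fun B _ => ((contDiff_pdV hL B).comp (contDiff_jet_s3 hq)).mul
      (contDiff_pi.1 (hφ.smul hms) B)).differentiable (by simp) t
  · exact ((hφ.mul (hKjet.clm_apply (hms.prodMk (hms'.prodMk contDiff_const)))).differentiable
      (by simp) t).add (((contDiff_infty_iff_deriv.1 hφ).2.differentiable (by simp) t).mul (hβs t))
end

section
/- Let L : ℝⁿ × ℝⁿ × ℝ → ℝ be a smooth Lagrangian and Φ : ℝⁿ × ℝ → ℝⁿ a smooth point transformation. Define the pulled-back Lagrangian L̃(q, v, t) := L(Φ(q, t), Σ_B (∂Φ/∂q^B)(q, t) v^B + (∂Φ/∂t)(q, t), t). Then for every smooth curve q : ℝ → ℝⁿ, every t ∈ ℝ and every index A: EL_A[L̃; q](t) = Σ_{B=1}^n (∂Φ^B/∂q^A)(q(t), t) · EL_B[L; Φ∘q](t), where (Φ∘q)(t) := Φ(q(t), t). In other words, the Euler–Lagrange expressions transform covariantly under point transformations, with the Jacobian matrix of Φ as the intertwiner. -/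
open scoped BigOperators

/-- The Euler–Lagrange expression of `L` along the curve `c`:
`EL_A[L; c](t) = ∂L/∂q^A(c, c', t) − (d/dt)[∂L/∂v^A(c, c', t)]`. -/
noncomputable def ELexpr (n : ℕ) (L : Conf n → ℝ) (c : ℝ → Fin n → ℝ)
    (A : Fin n) (t : ℝ) : ℝ :=
  pdQ n L A (c t, deriv c t, t) - deriv (fun s => pdV n L A (c s, deriv c s, s)) t

/-- Partial derivative `∂Φ^i/∂q^B` of a point transformation `Φ : ℝⁿ × ℝ → ℝⁿ`. -/
noncomputable def pdΦQ (n : ℕ) (Φ : (Fin n → ℝ) × ℝ → Fin n → ℝ) (i B : Fin n)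
    (p : (Fin n → ℝ) × ℝ) : ℝ :=
  fderiv ℝ (fun y => Φ y i) p (Pi.single B (1 : ℝ), 0)

/-- Partial derivative `∂Φ^i/∂t` of a point transformation `Φ : ℝⁿ × ℝ → ℝⁿ`. -/
noncomputable def pdΦT (n : ℕ) (Φ : (Fin n → ℝ) × ℝ → Fin n → ℝ) (i : Fin n)
    (p : (Fin n → ℝ) × ℝ) : ℝ :=
  fderiv ℝ (fun y => Φ y i) p (0, 1)

/-- The pulled-back Lagrangian
`L̃(q, v, t) := L(Φ(q, t), Σ_B ∂Φ/∂q^B v^B + ∂Φ/∂t, t)`. -/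
noncomputable def pullbackL (n : ℕ) (L : Conf n → ℝ)
    (Φ : (Fin n → ℝ) × ℝ → Fin n → ℝ) : Conf n → ℝ :=
  fun x =>
    L (Φ (x.1, x.2.2),
      fun i => (∑ B, pdΦQ n Φ i B (x.1, x.2.2) * x.2.1 B) + pdΦT n Φ i (x.1, x.2.2),
      x.2.2)

/-- The map `(q, v, t) ↦ (Φ(q, t), DΦ(q, t)(v, 1), t)` induced by a point transformation. -/
noncomputable def prolongation (n : ℕ) (Φ : (Fin n → ℝ) × ℝ → Fin n → ℝ) (x : Conf n) : Conf n :=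
  (Φ (x.1, x.2.2), fderiv ℝ Φ (x.1, x.2.2) (x.2.1, 1), x.2.2)

section PointTransformation

variable {n : ℕ} {L : Conf n → ℝ} {Φ : (Fin n → ℝ) × ℝ → Fin n → ℝ} {q : ℝ → Fin n → ℝ}

theorem pdΦQ_eq_fderiv_apply (hΦ : Differentiable ℝ Φ) (i B : Fin n) (p : (Fin n → ℝ) × ℝ) :
    pdΦQ n Φ i B p = fderiv ℝ Φ p (Pi.single B 1, 0) i := by
  rw [pdΦQ, fderiv_apply (hΦ p) i]
  rfl

theorem pdΦT_eq_fderiv_apply (hΦ : Differentiable ℝ Φ) (i : Fin n) (p : (Fin n → ℝ) × ℝ) :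
    pdΦT n Φ i p = fderiv ℝ Φ p (0, 1) i := by
  rw [pdΦT, fderiv_apply (hΦ p) i]
  rfl

theorem sum_pdΦQ_mul_add_pdΦT (hΦ : Differentiable ℝ Φ) (i : Fin n) (p : (Fin n → ℝ) × ℝ)
    (v : Fin n → ℝ) :
    (∑ B, pdΦQ n Φ i B p * v B) + pdΦT n Φ i p = fderiv ℝ Φ p (v, 1) i := by
  have hv : ((v, 1) : (Fin n → ℝ) × ℝ)
      = ContinuousLinearMap.inl ℝ _ ℝ (∑ B, v B • Pi.single B (1 : ℝ)) + (0, 1) := by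
    rw [← pi_eq_sum_univ' v]
    simp
  rw [hv, map_add, map_sum, map_sum]
  simp only [pdΦQ_eq_fderiv_apply hΦ, pdΦT_eq_fderiv_apply hΦ, map_smul, Pi.add_apply,
    Finset.sum_apply, Pi.smul_apply, smul_eq_mul, ContinuousLinearMap.inl_apply, mul_comm]

theorem pullbackL_eq_comp_prolongation (hΦ : Differentiable ℝ Φ) :
    pullbackL n L Φ = L ∘ prolongation n Φ := by
  funext x
  simp only [pullbackL, sum_pdΦQ_mul_add_pdΦT hΦ, Function.comp_apply, prolongation]

theorem fderiv_apply_config (x : Conf n) (w : Fin n → ℝ) :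
    fderiv ℝ L x (w, 0, 0) = ∑ B, w B * pdQ n L B x := by
  have hw : ((w, 0, 0) : Conf n)
      = ContinuousLinearMap.inl ℝ _ _ (∑ B, w B • Pi.single B (1 : ℝ)) := by
    rw [← pi_eq_sum_univ' w]
    rfl
  rw [hw, map_sum, map_sum]
  simp only [map_smul, smul_eq_mul, pdQ]
  rfl

theorem fderiv_apply_velocity (x : Conf n) (w : Fin n → ℝ) :
    fderiv ℝ L x (0, w, 0) = ∑ B, w B * pdV n L B x := by
  have hw : ((0, w, 0) : Conf n) = ContinuousLinearMap.inr ℝ (Fin n → ℝ) _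
      (ContinuousLinearMap.inl ℝ _ ℝ (∑ B, w B • Pi.single B (1 : ℝ))) := by
    rw [← pi_eq_sum_univ' w]
    rfl
  rw [hw, map_sum, map_sum, map_sum]
  simp only [map_smul, smul_eq_mul, pdV]
  rfl

theorem differentiable_fderiv (hΦ : ContDiff ℝ 2 Φ) : Differentiable ℝ (fderiv ℝ Φ) :=
  (hΦ.fderiv_right (m := 1) le_rfl).differentiable one_ne_zero

theorem hasFDerivAt_prolongation (hΦ : ContDiff ℝ 2 Φ) (x : Conf n) :
    ∃ P : Conf n →L[ℝ] Conf n, HasFDerivAt (prolongation n Φ) P x ∧ ∀ a b c,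
      P (a, b, c) = (fderiv ℝ Φ (x.1, x.2.2) (a, c),
        fderiv ℝ Φ (x.1, x.2.2) (b, 0)
          + fderiv ℝ (fderiv ℝ Φ) (x.1, x.2.2) (a, c) (x.2.1, 1), c) := by
  have hvt := hasFDerivAt_snd (𝕜 := ℝ) (p := x)
  have ht := hvt.snd
  have hp : HasFDerivAt (fun y : Conf n => (y.1, y.2.2)) _ x :=
    hasFDerivAt_fst.prodMk ht
  have hv := hvt.fst.prodMk (hasFDerivAt_const (1 : ℝ) x)
  have hD := (differentiable_fderiv hΦ (x.1, x.2.2)).hasFDerivAt.comp x hp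
  have hΦ' := (hΦ.differentiable two_ne_zero (x.1, x.2.2)).hasFDerivAt.comp x hp
  exact ⟨_, hΦ'.prodMk ((hD.clm_apply hv).prodMk ht),
    fun a b c => rfl⟩

theorem pdV_pullbackL (hL : Differentiable ℝ L) (hΦ : ContDiff ℝ 2 Φ) (A : Fin n) (x : Conf n) :
    pdV n (pullbackL n L Φ) A x
      = ∑ B, pdΦQ n Φ B A (x.1, x.2.2) * pdV n L B (prolongation n Φ x) := by
  have hΦ' := hΦ.differentiable two_ne_zero
  obtain ⟨P, hP, hPapply⟩ := hasFDerivAt_prolongation hΦ x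
  rw [pdV, pullbackL_eq_comp_prolongation hΦ', ((hL _).hasFDerivAt.comp x hP).fderiv,
    ContinuousLinearMap.comp_apply, hPapply]
  simp only [← Prod.zero_eq_mk, map_zero, zero_apply, add_zero,
    pdΦQ_eq_fderiv_apply hΦ']
  exact fderiv_apply_velocity _ _

theorem pdQ_pullbackL (hL : Differentiable ℝ L) (hΦ : ContDiff ℝ 2 Φ) (A : Fin n) (x : Conf n) :
    pdQ n (pullbackL n L Φ) A x
      = ∑ B, (pdΦQ n Φ B A (x.1, x.2.2) * pdQ n L B (prolongation n Φ x)
        + fderiv ℝ (fderiv ℝ Φ) (x.1, x.2.2) (Pi.single A 1, 0) (x.2.1, 1) B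
          * pdV n L B (prolongation n Φ x)) := by
  have hΦ' := hΦ.differentiable two_ne_zero
  obtain ⟨P, hP, hPapply⟩ := hasFDerivAt_prolongation hΦ x
  have hsplit (a b : Fin n → ℝ) : ((a, b, 0) : Conf n) = (a, 0, 0) + (0, b, 0) := by simp
  rw [pdQ, pullbackL_eq_comp_prolongation hΦ', ((hL _).hasFDerivAt.comp x hP).fderiv,
    ContinuousLinearMap.comp_apply, hPapply, hsplit, map_add, fderiv_apply_config,
    fderiv_apply_velocity, Finset.sum_add_distrib]
  simp only [pdΦQ_eq_fderiv_apply hΦ', Prod.mk_zero_zero, map_zero, zero_add]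

theorem hasDerivAt_pdΦQ_curve (hΦ : ContDiff ℝ 2 Φ) (hq : Differentiable ℝ q) (A B : Fin n)
    (t : ℝ) :
    HasDerivAt (fun s => pdΦQ n Φ B A (q s, s))
      (fderiv ℝ (fderiv ℝ Φ) (q t, t) (Pi.single A 1, 0) (deriv q t, 1) B) t := by
  have hsymm : IsSymmSndFDerivAt ℝ Φ (q t, t) :=
    hΦ.contDiffAt.isSymmSndFDerivAt (by simp)
  have hcurve : HasDerivAt (fun s => (q s, s)) (deriv q t, 1) t :=
    (hq t).hasDerivAt.prodMk (hasDerivAt_id t)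
  have hD := (differentiable_fderiv hΦ (q t, t)).hasFDerivAt.comp_hasDerivAt_of_eq t hcurve rfl
  have h := hasDerivAt_pi.1 (hD.clm_apply (hasDerivAt_const t (Pi.single A (1 : ℝ), (0 : ℝ)))) B
  simp only [pdΦQ_eq_fderiv_apply (hΦ.differentiable two_ne_zero)]
  rw [hsymm.eq]
  simpa using h

theorem prolongation_curve (hΦ : Differentiable ℝ Φ) (hq : Differentiable ℝ q) (s : ℝ) :
    prolongation n Φ (q s, deriv q s, s)
      = (Φ (q s, s), deriv (fun r => Φ (q r, r)) s, s) := by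
  have hcurve : HasDerivAt (fun r => (q r, r)) (deriv q s, 1) s :=
    (hq s).hasDerivAt.prodMk (hasDerivAt_id s)
  have h : HasDerivAt (fun r => Φ (q r, r)) _ s :=
    (hΦ (q s, s)).hasFDerivAt.comp_hasDerivAt_of_eq s hcurve rfl
  rw [h.deriv]
  rfl

theorem differentiable_pdV_curve (hL : ContDiff ℝ 2 L) {c : ℝ → Fin n → ℝ} (hc : ContDiff ℝ 2 c)
    (B : Fin n) : Differentiable ℝ (fun s => pdV n L B (c s, deriv c s, s)) := by
  have hL' : Differentiable ℝ (fderiv ℝ L) :=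
    (hL.fderiv_right (m := 1) le_rfl).differentiable one_ne_zero
  have hc' : Differentiable ℝ (deriv c) := hc.differentiable_deriv_two
  have hc₀ : Differentiable ℝ c := hc.differentiable two_ne_zero
  have hcurve : Differentiable ℝ (fun s => (c s, deriv c s, s)) :=
    hc₀.prodMk (hc'.prodMk differentiable_id)
  exact (hL'.comp hcurve).clm_apply (differentiable_const _)

end PointTransformation

/-- Covariance of the Euler–Lagrange expressions under point transformations:
`EL_A[L̃; q](t) = Σ_B (∂Φ^B/∂q^A)(q(t), t) · EL_B[L; Φ∘q](t)`. -/
theorem eulerLagrange_covariant_under_point_transformations (n : ℕ)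
    (L : Conf n → ℝ) (hL : ContDiff ℝ (⊤ : ℕ∞) L)
    (Φ : (Fin n → ℝ) × ℝ → Fin n → ℝ) (hΦ : ContDiff ℝ (⊤ : ℕ∞) Φ) :
    ∀ q : ℝ → Fin n → ℝ, ContDiff ℝ (⊤ : ℕ∞) q → ∀ (t : ℝ) (A : Fin n),
      ELexpr n (pullbackL n L Φ) q A t
        = ∑ B, pdΦQ n Φ B A (q t, t) * ELexpr n L (fun s => Φ (q s, s)) B t := by
  intro q hq t A
  have hle : (2 : WithTop ℕ∞) ≤ ((⊤ : ℕ∞) : WithTop ℕ∞) := WithTop.coe_le_coe.2 le_top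
  have hL₂ := hL.of_le hle
  have hΦ₂ := hΦ.of_le hle
  have hq₂ := hq.of_le hle
  have hL₁ := hL₂.differentiable two_ne_zero
  have hΦ₁ := hΦ₂.differentiable two_ne_zero
  have hq₁ := hq₂.differentiable two_ne_zero
  have hc : ContDiff ℝ 2 (fun s => Φ (q s, s)) := hΦ₂.comp (hq₂.prodMk contDiff_id)
  have hderiv := HasDerivAt.fun_sum (u := Finset.univ) fun B _ =>
    (hasDerivAt_pdΦQ_curve hΦ₂ hq₁ A B t).fun_mul
      (differentiable_pdV_curve hL₂ hc B t).hasDerivAt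
  simp only [ELexpr, pdV_pullbackL hL₁ hΦ₂, pdQ_pullbackL hL₁ hΦ₂, prolongation_curve hΦ₁ hq₁]
  rw [hderiv.deriv, ← Finset.sum_sub_distrib]
  exact Finset.sum_congr rfl fun B _ => by ring
end

section
/- Suppose (δq, δK) is an off-shell infinitesimal symmetry of the smooth Lagrangian L : ℝⁿ × ℝⁿ × ℝ → ℝ. Then for all (q, v, t) ∈ ℝⁿ × ℝⁿ × ℝ and all indices A, C: (i) Σ_{B=1}^n (∂(δq^B)/∂v^A) (∂L/∂v^B) = ∂(δK)/∂v^A, and (ii) the integrability condition Σ_{B=1}^n (∂(δq^B)/∂v^C)(∂²L/∂v^B∂v^A) = Σ_{B=1}^n (∂(δq^B)/∂v^A)(∂²L/∂v^B∂v^C) holds. -/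
open scoped BigOperators

/-- Partial velocity derivatives of a smooth function are smooth. -/
theorem ContDiff.pdV {n : ℕ} {f : Conf n → ℝ} (hf : ContDiff ℝ (⊤ : ℕ∞) f) (A : Fin n) :
    ContDiff ℝ (⊤ : ℕ∞) (pdV n f A) :=
  (hf.fderiv_right (m := (⊤ : ℕ∞)) (by simp)).clm_apply contDiff_const

/-- Partial velocity derivatives of a smooth function commute. -/
theorem pdV_pdV_comm {n : ℕ} {f : Conf n → ℝ} (hf : ContDiff ℝ (⊤ : ℕ∞) f) (A B : Fin n)
    (x : Conf n) : pdV n (pdV n f A) B x = pdV n (pdV n f B) A x := by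
  have hd : DifferentiableAt ℝ (fderiv ℝ f) x :=
    (hf.fderiv_right (m := (⊤ : ℕ∞)) (by simp)).differentiable (by simp) x
  have key (A B : Fin n) : pdV n (pdV n f A) B x =
      fderiv ℝ (fderiv ℝ f) x (0, Pi.single B 1, 0) (0, Pi.single A 1, 0) := by
    change fderiv ℝ (fun y => fderiv ℝ f y (0, Pi.single A 1, 0)) x _ = _
    rw [fderiv_clm_apply hd (differentiableAt_const _)]
    simp
  rw [key, key]
  exact (hf.contDiffAt.isSymmSndFDerivAt
    (by simpa using WithTop.coe_le_coe.mpr (le_top : (2 : ℕ∞) ≤ ⊤))) _ _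

/-- Leibniz rule for the velocity derivative of a finite sum of products. -/
theorem pdV_sum_mul {n : ℕ} {ι : Type*} [Fintype ι] {f g : ι → Conf n → ℝ} {x : Conf n}
    (hf : ∀ i, DifferentiableAt ℝ (f i) x) (hg : ∀ i, DifferentiableAt ℝ (g i) x) (A : Fin n) :
    pdV n (fun y => ∑ i, f i y * g i y) A x =
      ∑ i, f i x * pdV n (g i) A x + ∑ i, pdV n (f i) A x * g i x := by
  unfold pdV
  rw [fderiv_fun_sum (fun i _ => (hf i).fun_mul (hg i)), ← Finset.sum_add_distrib,
    sum_apply]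
  refine Finset.sum_congr rfl fun i _ => ?_
  rw [fderiv_fun_mul (hf i) (hg i)]
  simp [mul_comm]

/-- The velocity gradient of `δK`, read off from the terms linear in the acceleration. -/
theorem IsOffShellSymmetry.sum_pdV_mul_pdV {n : ℕ} {L δK : Conf n → ℝ}
    {δq : Conf n → Fin n → ℝ} (hsym : IsOffShellSymmetry n L δq δK) (A : Fin n) (x : Conf n) :
    ∑ B, pdV n (fun y => δq y B) A x * pdV n L B x = pdV n δK A x := by
  obtain ⟨q, v, t⟩ := x
  have h₁ := hsym q v (Pi.single A 1) t
  have h₀ := hsym q v 0 t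
  simp only [deltaV, add_mul, Finset.sum_add_distrib, Pi.single_apply, ite_mul, one_mul,
    zero_mul, Finset.sum_ite_eq', Finset.mem_univ, if_true, Pi.zero_apply,
    Finset.sum_const_zero] at h₁ h₀
  linarith

/-- If `(δq, δK)` is an off-shell infinitesimal symmetry of the smooth Lagrangian `L`, then
(i) `Σ_B (∂(δq^B)/∂v^A)(∂L/∂v^B) = ∂(δK)/∂v^A`, and
(ii) the integrability condition
`Σ_B (∂(δq^B)/∂v^C)(∂²L/∂v^B∂v^A) = Σ_B (∂(δq^B)/∂v^A)(∂²L/∂v^B∂v^C)` holds. -/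
theorem offShellSymmetry_velocity_identities (n : ℕ)
    (L δK : Conf n → ℝ) (δq : Conf n → Fin n → ℝ)
    (hL : ContDiff ℝ (⊤ : ℕ∞) L) (hδK : ContDiff ℝ (⊤ : ℕ∞) δK)
    (hδq : ContDiff ℝ (⊤ : ℕ∞) δq)
    (hsym : IsOffShellSymmetry n L δq δK) :
    (∀ (q v : Fin n → ℝ) (t : ℝ) (A : Fin n),
      (∑ B, pdV n (fun x => δq x B) A (q, v, t) * pdV n L B (q, v, t))
        = pdV n δK A (q, v, t))
    ∧ (∀ (q v : Fin n → ℝ) (t : ℝ) (A C : Fin n),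
      (∑ B, pdV n (fun x => δq x B) C (q, v, t) * pdV n (pdV n L A) B (q, v, t))
        = ∑ B, pdV n (fun x => δq x B) A (q, v, t) * pdV n (pdV n L C) B (q, v, t)) := by
  refine ⟨fun q v t A => hsym.sum_pdV_mul_pdV A (q, v, t), fun q v t A C => ?_⟩
  have hq (B : Fin n) : ContDiff ℝ (⊤ : ℕ∞) (fun x => δq x B) := contDiff_pi.mp hδq B
  have key (A C : Fin n) := (pdV_sum_mul (x := (q, v, t))
    (fun B => ((hq B).pdV A).differentiable (by simp) _)
    (fun B => (hL.pdV B).differentiable (by simp) _) C).symm.trans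
    (congrArg (fun f => pdV n f C (q, v, t)) (funext (hsym.sum_pdV_mul_pdV A)))
  have h₁ := key C A
  have h₂ := key A C
  have hK := pdV_pdV_comm hδK A C (q, v, t)
  simp only [fun B => pdV_pdV_comm (hq B) C A (q, v, t),
    fun B => pdV_pdV_comm hL B A (q, v, t)] at h₁
  simp only [fun B => pdV_pdV_comm hL B C (q, v, t)] at h₂
  change _ = pdV n (pdV n δK C) A (q, v, t) at h₁
  change _ = pdV n (pdV n δK A) C (q, v, t) at h₂
  linarith
end

section
/- With the Dirac bracket defined from the constraint functions ρ₁,…,ρ_m, the Jacobi identity holds: for all smooth functions F, G, H : ℝ²ⁿ → ℝ, [[F, G]_D, H]_D + [[G, H]_D, F]_D + [[H, F]_D, G]_D = 0 identically on ℝ²ⁿ. -/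
open scoped BigOperators

/-- The matrix `Ω_{st}(x) = {ρ_s, ρ_t}(x)` of Poisson brackets of the constraints. -/
noncomputable def OmegaMat (n m : ℕ) (ρ : Fin m → Phase n → ℝ) (x : Phase n) :
    Matrix (Fin m) (Fin m) ℝ :=
  Matrix.of fun s t => poissonBracket n (ρ s) (ρ t) x

/-- The Dirac bracket associated with the constraints `ρ`:
`[F, G]_D = {F, G} − Σ_{s,t} {F, ρ_s} (Ω⁻¹)^{st} {ρ_t, G}`. -/
noncomputable def diracBracket (n m : ℕ) (ρ : Fin m → Phase n → ℝ)
    (F G : Phase n → ℝ) (x : Phase n) : ℝ :=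
  poissonBracket n F G x
    - ∑ s, ∑ t,
        poissonBracket n F (ρ s) x * (OmegaMat n m ρ x)⁻¹ s t * poissonBracket n (ρ t) G x

/-- The Hamiltonian vector `X_G = (∂G/∂p, -∂G/∂q)` at `x`. -/
noncomputable def hamiltonianVector (n : ℕ) (G : Phase n → ℝ) (x : Phase n) : Phase n :=
  ∑ A : Fin n, (fderiv ℝ G x (Pi.single (Sum.inr A) 1) • Pi.single (Sum.inl A) 1
    - fderiv ℝ G x (Pi.single (Sum.inl A) 1) • Pi.single (Sum.inr A) 1)

theorem apply_hamiltonianVector (n : ℕ) (L : Phase n →L[ℝ] ℝ) (G : Phase n → ℝ) (x : Phase n) :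
    L (hamiltonianVector n G x) = ∑ A : Fin n,
      (L (Pi.single (Sum.inl A) 1) * fderiv ℝ G x (Pi.single (Sum.inr A) 1)
        - L (Pi.single (Sum.inr A) 1) * fderiv ℝ G x (Pi.single (Sum.inl A) 1)) := by
  simp only [hamiltonianVector, map_sum, map_sub, map_smul, smul_eq_mul]
  exact Finset.sum_congr rfl fun A _ => by ring

theorem poissonBracket_eq_fderiv (n : ℕ) (F G : Phase n → ℝ) (x : Phase n) :
    poissonBracket n F G x = fderiv ℝ F x (hamiltonianVector n G x) :=
  (apply_hamiltonianVector n _ G x).symm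

theorem poissonBracket_antisymm (n : ℕ) (F G : Phase n → ℝ) (x : Phase n) :
    poissonBracket n F G x = -poissonBracket n G F x := by
  simp only [poissonBracket, ← Finset.sum_neg_distrib]
  exact Finset.sum_congr rfl fun A _ => by ring

theorem poissonBracket_sub_sum_left (n m : ℕ) (ρ : Fin m → Phase n → ℝ) (c : Fin m → ℝ)
    (F G : Phase n → ℝ) (x : Phase n) (hF : DifferentiableAt ℝ F x)
    (hρ : ∀ s, DifferentiableAt ℝ (ρ s) x) :
    poissonBracket n (fun y => F y - ∑ s, c s * ρ s y) G x
      = poissonBracket n F G x - ∑ s, c s * poissonBracket n (ρ s) G x := by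
  have h : HasFDerivAt (fun y => F y - ∑ s, c s * ρ s y)
      (fderiv ℝ F x - ∑ s, c s • fderiv ℝ (ρ s) x) x :=
    hF.hasFDerivAt.fun_sub (HasFDerivAt.fun_sum fun s _ => (hρ s).hasFDerivAt.const_mul (c s))
  simp [poissonBracket_eq_fderiv, h.fderiv]

theorem poissonBracket_sub_sum_right (n m : ℕ) (ρ : Fin m → Phase n → ℝ) (c : Fin m → ℝ)
    (F G : Phase n → ℝ) (x : Phase n) (hG : DifferentiableAt ℝ G x)
    (hρ : ∀ s, DifferentiableAt ℝ (ρ s) x) :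
    poissonBracket n F (fun y => G y - ∑ s, c s * ρ s y) x
      = poissonBracket n F G x - ∑ s, c s * poissonBracket n F (ρ s) x := by
  rw [poissonBracket_antisymm, poissonBracket_sub_sum_left n m ρ c G F x hG hρ,
    poissonBracket_antisymm n F G]
  simp only [poissonBracket_antisymm n F (ρ _), mul_neg, Finset.sum_neg_distrib]
  ring

theorem hasFDerivAt_poissonBracket (n : ℕ) {F G : Phase n → ℝ} {x : Phase n}
    (hF : DifferentiableAt ℝ (fderiv ℝ F) x) (hG : DifferentiableAt ℝ (fderiv ℝ G) x) :
    HasFDerivAt (poissonBracket n F G)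
      ((fderiv ℝ (fderiv ℝ F) x).flip (hamiltonianVector n G x)
        - (fderiv ℝ (fderiv ℝ G) x).flip (hamiltonianVector n F x)) x := by
  have key {K : Phase n → ℝ} (hK : DifferentiableAt ℝ (fderiv ℝ K) x) (e : Phase n) :
      HasFDerivAt (fun y => fderiv ℝ K y e) ((fderiv ℝ (fderiv ℝ K) x).flip e) x := by
    refine (hK.hasFDerivAt.clm_apply (hasFDerivAt_const e x)).congr_fderiv ?_
    ext v
    simp
  have h := HasFDerivAt.fun_sum (u := Finset.univ) fun (A : Fin n) _ =>
    ((key hF (Pi.single (Sum.inl A) 1)).fun_mul (key hG (Pi.single (Sum.inr A) 1))).fun_sub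
      ((key hF (Pi.single (Sum.inr A) 1)).fun_mul (key hG (Pi.single (Sum.inl A) 1)))
  refine h.congr_fderiv (ContinuousLinearMap.ext fun v => ?_)
  simp only [sub_apply, ContinuousLinearMap.flip_apply,
    apply_hamiltonianVector, sum_apply, add_apply,
    smul_apply, smul_eq_mul, ← Finset.sum_sub_distrib]
  exact Finset.sum_congr rfl fun A _ => by ring

theorem ContDiff.differentiable_fderiv_of_smooth {n : ℕ} {F : Phase n → ℝ}
    (hF : ContDiff ℝ (⊤ : ℕ∞) F) : Differentiable ℝ (fderiv ℝ F) :=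
  (hF.fderiv_right (m := 1) (WithTop.coe_le_coe.mpr le_top)).differentiable (by norm_num)

theorem poissonBracket_jacobi (n : ℕ) {F G H : Phase n → ℝ}
    (hF : ContDiff ℝ (⊤ : ℕ∞) F) (hG : ContDiff ℝ (⊤ : ℕ∞) G)
    (hH : ContDiff ℝ (⊤ : ℕ∞) H) (x : Phase n) :
    poissonBracket n (poissonBracket n F G) H x + poissonBracket n (poissonBracket n G H) F x
      + poissonBracket n (poissonBracket n H F) G x = 0 := by
  have symm {K : Phase n → ℝ} (hK : ContDiff ℝ (⊤ : ℕ∞) K) (v w : Phase n) :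
      fderiv ℝ (fderiv ℝ K) x v w = fderiv ℝ (fderiv ℝ K) x w v :=
    (hK.contDiffAt.isSymmSndFDerivAt (by simpa using WithTop.coe_le_coe.mpr (le_top : (2 : ℕ∞) ≤ ⊤))).eq v w
  have dF := hF.differentiable_fderiv_of_smooth x
  have dG := hG.differentiable_fderiv_of_smooth x
  have dH := hH.differentiable_fderiv_of_smooth x
  simp only [poissonBracket_eq_fderiv n (poissonBracket n _ _),
    (hasFDerivAt_poissonBracket n dF dG).fderiv, (hasFDerivAt_poissonBracket n dG dH).fderiv,
    (hasFDerivAt_poissonBracket n dH dF).fderiv, sub_apply,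
    ContinuousLinearMap.flip_apply]
  rw [symm hF (hamiltonianVector n H x), symm hG (hamiltonianVector n H x),
    symm hH (hamiltonianVector n F x)]
  ring

section MatrixInverse

variable {E ι : Type*} [NormedAddCommGroup E] [NormedSpace ℝ E] [Fintype ι] [DecidableEq ι]

theorem Matrix.differentiableAt_det {M : E → Matrix ι ι ℝ} {x : E}
    (hM : ∀ i j, DifferentiableAt ℝ (fun y => M y i j) x) :
    DifferentiableAt ℝ (fun y => (M y).det) x := by
  simp only [Matrix.det_apply']
  fun_prop

theorem Matrix.differentiableAt_inv_apply {M : E → Matrix ι ι ℝ} {x : E}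
    (hM : ∀ i j, DifferentiableAt ℝ (fun y => M y i j) x) (hx : IsUnit (M x)) (i j : ι) :
    DifferentiableAt ℝ (fun y => (M y)⁻¹ i j) x := by
  have hdet : (M x).det ≠ 0 := ((Matrix.isUnit_iff_isUnit_det _).mp hx).ne_zero
  simp only [Matrix.inv_def, Matrix.smul_apply, Ring.inverse_eq_inv', smul_eq_mul,
    Matrix.adjugate_apply]
  refine ((Matrix.differentiableAt_det hM).fun_inv hdet).fun_mul
    (Matrix.differentiableAt_det fun k l => ?_)
  simp only [Matrix.updateRow_apply]
  split_ifs
  · exact differentiableAt_const _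
  · exact hM k l

end MatrixInverse

theorem diracBracket_eq_dotProduct (n m : ℕ) (ρ : Fin m → Phase n → ℝ) (F G : Phase n → ℝ)
    (x : Phase n) :
    diracBracket n m ρ F G x = poissonBracket n F G x
      - dotProduct (fun s => poissonBracket n F (ρ s) x)
          ((OmegaMat n m ρ x)⁻¹.mulVec fun t => poissonBracket n (ρ t) G x) := by
  simp only [diracBracket, dotProduct, Matrix.mulVec, Finset.mul_sum, mul_assoc]

theorem diracBracket_sub_sum_left (n m : ℕ) (ρ : Fin m → Phase n → ℝ) (c : Fin m → ℝ)
    (F G : Phase n → ℝ) (x : Phase n) (hF : DifferentiableAt ℝ F x)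
    (hρ : ∀ s, DifferentiableAt ℝ (ρ s) x) (hΩ : IsUnit (OmegaMat n m ρ x)) :
    diracBracket n m ρ (fun y => F y - ∑ s, c s * ρ s y) G x = diracBracket n m ρ F G x := by
  have hdet := (Matrix.isUnit_iff_isUnit_det _).mp hΩ
  have hu : (fun t => poissonBracket n (fun y => F y - ∑ s, c s * ρ s y) (ρ t) x)
      = (fun t => poissonBracket n F (ρ t) x) - Matrix.vecMul c (OmegaMat n m ρ x) := by
    ext t
    simp [poissonBracket_sub_sum_left n m ρ c F _ x hF hρ, Matrix.vecMul, dotProduct, OmegaMat]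
  rw [diracBracket_eq_dotProduct, diracBracket_eq_dotProduct, hu, sub_dotProduct,
    ← Matrix.dotProduct_mulVec, Matrix.mulVec_mulVec, Matrix.mul_nonsing_inv _ hdet,
    Matrix.one_mulVec, poissonBracket_sub_sum_left n m ρ c F G x hF hρ]
  simp only [dotProduct]
  ring

theorem diracBracket_sub_sum_right (n m : ℕ) (ρ : Fin m → Phase n → ℝ) (c : Fin m → ℝ)
    (F G : Phase n → ℝ) (x : Phase n) (hG : DifferentiableAt ℝ G x)
    (hρ : ∀ s, DifferentiableAt ℝ (ρ s) x) (hΩ : IsUnit (OmegaMat n m ρ x)) :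
    diracBracket n m ρ F (fun y => G y - ∑ s, c s * ρ s y) x = diracBracket n m ρ F G x := by
  have hdet := (Matrix.isUnit_iff_isUnit_det _).mp hΩ
  have hv : (fun t => poissonBracket n (ρ t) (fun y => G y - ∑ s, c s * ρ s y) x)
      = (fun t => poissonBracket n (ρ t) G x) - (OmegaMat n m ρ x).mulVec c := by
    ext t
    simp [poissonBracket_sub_sum_right n m ρ c _ G x hG hρ, Matrix.mulVec, dotProduct, OmegaMat]
    simp only [mul_comm (c _)]
  rw [diracBracket_eq_dotProduct, diracBracket_eq_dotProduct, hv, Matrix.mulVec_sub,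
    dotProduct_sub, Matrix.mulVec_mulVec, Matrix.nonsing_inv_mul _ hdet,
    Matrix.one_mulVec, poissonBracket_sub_sum_right n m ρ c F G x hG hρ]
  simp only [dotProduct, mul_comm (c _)]
  ring

/-- Subtracting a constant combination of the constraints makes a function commute with all
constraints at a given point. -/
theorem exists_poissonBracket_constraint_eq_zero (n m : ℕ) (ρ : Fin m → Phase n → ℝ)
    (F : Phase n → ℝ) (x : Phase n) (hF : DifferentiableAt ℝ F x)
    (hρ : ∀ s, DifferentiableAt ℝ (ρ s) x) (hΩ : IsUnit (OmegaMat n m ρ x)) :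
    ∃ c : Fin m → ℝ, ∀ t,
      poissonBracket n (fun y => F y - ∑ s, c s * ρ s y) (ρ t) x = 0 := by
  have hdet := (Matrix.isUnit_iff_isUnit_det _).mp hΩ
  refine ⟨Matrix.vecMul (fun t => poissonBracket n F (ρ t) x) (OmegaMat n m ρ x)⁻¹, fun t => ?_⟩
  have h := congrFun (Matrix.vecMul_vecMul (fun t => poissonBracket n F (ρ t) x)
    (OmegaMat n m ρ x)⁻¹ (OmegaMat n m ρ x)) t
  rw [Matrix.nonsing_inv_mul _ hdet, Matrix.vecMul_one] at h
  rw [poissonBracket_sub_sum_left n m ρ _ F _ x hF hρ, sub_eq_zero]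
  exact h.symm

theorem hasFDerivAt_mul_mul_of_eq_zero {E : Type*} [NormedAddCommGroup E] [NormedSpace ℝ E]
    {a w b : E → ℝ} {x : E} (ha : DifferentiableAt ℝ a x) (hw : DifferentiableAt ℝ w x)
    (hb : DifferentiableAt ℝ b x) (ha0 : a x = 0) (hb0 : b x = 0) :
    HasFDerivAt (fun y => a y * w y * b y) (0 : E →L[ℝ] ℝ) x := by
  refine ((ha.hasFDerivAt.fun_mul hw.hasFDerivAt).fun_mul hb.hasFDerivAt).congr_fderiv ?_
  simp [ha0, hb0]

/-- At a point where all three functions commute with the constraints, the iterated Dirac bracket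
is the iterated Poisson bracket. -/
theorem diracBracket_diracBracket_of_commute (n m : ℕ) (ρ : Fin m → Phase n → ℝ)
    (hρ : ∀ s, ContDiff ℝ (⊤ : ℕ∞) (ρ s)) {F G H : Phase n → ℝ}
    (hF : ContDiff ℝ (⊤ : ℕ∞) F) (hG : ContDiff ℝ (⊤ : ℕ∞) G) (x : Phase n)
    (hΩ : IsUnit (OmegaMat n m ρ x))
    (hF0 : ∀ t, poissonBracket n F (ρ t) x = 0) (hG0 : ∀ t, poissonBracket n G (ρ t) x = 0)
    (hH0 : ∀ t, poissonBracket n H (ρ t) x = 0) :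
    diracBracket n m ρ (diracBracket n m ρ F G) H x
      = poissonBracket n (poissonBracket n F G) H x := by
  have diff {K L : Phase n → ℝ} (hK : ContDiff ℝ (⊤ : ℕ∞) K) (hL : ContDiff ℝ (⊤ : ℕ∞) L) :
      DifferentiableAt ℝ (poissonBracket n K L) x :=
    (hasFDerivAt_poissonBracket n (hK.differentiable_fderiv_of_smooth x)
      (hL.differentiable_fderiv_of_smooth x)).differentiableAt
  have h : HasFDerivAt (diracBracket n m ρ F G)
      (fderiv ℝ (poissonBracket n F G) x - ∑ _s : Fin m, ∑ _t : Fin m, 0) x :=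
    (diff hF hG).hasFDerivAt.fun_sub (HasFDerivAt.fun_sum fun s _ => HasFDerivAt.fun_sum fun t _ =>
      hasFDerivAt_mul_mul_of_eq_zero (diff hF (hρ s))
        (Matrix.differentiableAt_inv_apply (fun i j => diff (hρ i) (hρ j)) hΩ s t)
        (diff (hρ t) hG) (hF0 s) (by rw [poissonBracket_antisymm, hG0, neg_zero]))
  have hH0' (t : Fin m) : poissonBracket n (ρ t) H x = 0 := by
    rw [poissonBracket_antisymm, hH0, neg_zero]
  rw [diracBracket]
  simp [hH0', poissonBracket_eq_fderiv n _ H, h.fderiv]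

/-- The Dirac bracket satisfies the Jacobi identity:
`[[F, G]_D, H]_D + [[G, H]_D, F]_D + [[H, F]_D, G]_D = 0` identically on `ℝ²ⁿ`. -/
theorem diracBracket_jacobi (n m : ℕ)
    (ρ : Fin m → Phase n → ℝ) (hρ : ∀ s, ContDiff ℝ (⊤ : ℕ∞) (ρ s))
    (hΩ : ∀ x : Phase n, IsUnit (OmegaMat n m ρ x))
    (F G H : Phase n → ℝ)
    (hF : ContDiff ℝ (⊤ : ℕ∞) F) (hG : ContDiff ℝ (⊤ : ℕ∞) G)
    (hH : ContDiff ℝ (⊤ : ℕ∞) H) :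
    ∀ x : Phase n,
      diracBracket n m ρ (fun y => diracBracket n m ρ F G y) H x
        + diracBracket n m ρ (fun y => diracBracket n m ρ G H y) F x
        + diracBracket n m ρ (fun y => diracBracket n m ρ H F y) G x = 0 := by
  intro x
  have dρ (y : Phase n) (s : Fin m) : DifferentiableAt ℝ (ρ s) y :=
    (hρ s).differentiable (by simp) y
  have dF : Differentiable ℝ F := hF.differentiable (by simp)
  have dG : Differentiable ℝ G := hG.differentiable (by simp)
  have dH : Differentiable ℝ H := hH.differentiable (by simp)
  obtain ⟨a, ha⟩ := exists_poissonBracket_constraint_eq_zero n m ρ F x (dF x) (dρ x) (hΩ x)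
  obtain ⟨b, hb⟩ := exists_poissonBracket_constraint_eq_zero n m ρ G x (dG x) (dρ x) (hΩ x)
  obtain ⟨c, hc⟩ := exists_poissonBracket_constraint_eq_zero n m ρ H x (dH x) (dρ x) (hΩ x)
  have smooth {K : Phase n → ℝ} (hK : ContDiff ℝ (⊤ : ℕ∞) K) (k : Fin m → ℝ) :
      ContDiff ℝ (⊤ : ℕ∞) fun y => K y - ∑ s, k s * ρ s y :=
    hK.sub (ContDiff.sum fun s _ => contDiff_const.mul (hρ s))
  have shift {K L : Phase n → ℝ} (hK : Differentiable ℝ K) (hL : Differentiable ℝ L)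
      (k l : Fin m → ℝ) : diracBracket n m ρ (fun y => K y - ∑ s, k s * ρ s y)
        (fun y => L y - ∑ s, l s * ρ s y) = diracBracket n m ρ K L := by
    ext y
    rw [diracBracket_sub_sum_left n m ρ k K _ y (hK y) (dρ y) (hΩ y),
      diracBracket_sub_sum_right n m ρ l K L y (hL y) (dρ y) (hΩ y)]
  have hFGH := diracBracket_diracBracket_of_commute n m ρ hρ (smooth hF a) (smooth hG b) x (hΩ x)
    ha hb hc
  have hGHF := diracBracket_diracBracket_of_commute n m ρ hρ (smooth hG b) (smooth hH c) x (hΩ x)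
    hb hc ha
  have hHFG := diracBracket_diracBracket_of_commute n m ρ hρ (smooth hH c) (smooth hF a) x (hΩ x)
    hc ha hb
  rw [shift dF dG, diracBracket_sub_sum_right n m ρ c _ H x (dH x) (dρ x) (hΩ x)] at hFGH
  rw [shift dG dH, diracBracket_sub_sum_right n m ρ a _ F x (dF x) (dρ x) (hΩ x)] at hGHF
  rw [shift dH dF, diracBracket_sub_sum_right n m ρ b _ G x (dG x) (dρ x) (hΩ x)] at hHFG
  rw [hFGH, hGHF, hHFG]
  exact poissonBracket_jacobi n (smooth hF a) (smooth hG b) (smooth hH c) x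
end

section
/- Let V be a real vector space and let A be an N×N matrix with entries in the Grassmann (exterior) algebra Λ(V) = ExteriorAlgebra ℝ V. Then A is invertible in the ring of N×N matrices over Λ(V) if and only if its body matrix ε(A) (the real N×N matrix obtained by applying the body map ε entrywise) is invertible, i.e. if and only if det(ε(A)) ≠ 0. -/
open Matrix

/-- In a possibly noncommutative ring, `1` plus an element of the Jacobson radical is a unit. -/
theorem Ideal.isUnit_of_sub_one_mem_jacobson_bot_of_ring {S : Type*} [Ring S] (r : S)
    (h : r - 1 ∈ Ideal.jacobson (⊥ : Ideal S)) : IsUnit r := by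
  obtain ⟨s, hs⟩ := Ideal.exists_mul_sub_mem_of_sub_one_mem_jacobson r h
  have hsr : s * r = 1 := sub_eq_zero.mp (Ideal.mem_bot.mp hs)
  have hs' : s - 1 ∈ Ideal.jacobson (⊥ : Ideal S) := by
    have : s - 1 = -s * (r - 1) := by rw [neg_mul, mul_sub, hsr, mul_one, neg_sub]
    exact this ▸ Ideal.mul_mem_left _ _ h
  obtain ⟨t, ht⟩ := Ideal.exists_mul_sub_mem_of_sub_one_mem_jacobson s hs'
  have hts : t * s = 1 := sub_eq_zero.mp (Ideal.mem_bot.mp ht)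
  have htr : t = r := left_inv_eq_right_inv hts hsr
  exact ⟨⟨r, s, htr ▸ hts, hsr⟩, rfl⟩

namespace ExteriorAlgebra

variable {R M : Type*} [CommRing R] [AddCommGroup M] [Module R M]

theorem exists_ι_mul_eq_mul_ι (v : M) (y : ExteriorAlgebra R M) :
    ∃ y', ι R v * y = y' * ι R v := by
  induction y using ExteriorAlgebra.induction with
  | algebraMap r => exact ⟨_, (Algebra.commutes r (ι R v)).symm⟩
  | ι w => exact ⟨-ι R w, by rw [neg_mul]; exact eq_neg_of_add_eq_zero_left (ι_add_mul_swap v w)⟩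
  | mul a b ha hb =>
    obtain ⟨a', ha⟩ := ha
    obtain ⟨b', hb⟩ := hb
    exact ⟨a' * b', by rw [← mul_assoc, ha, mul_assoc, hb, mul_assoc]⟩
  | add a b ha hb =>
    obtain ⟨a', ha⟩ := ha
    obtain ⟨b', hb⟩ := hb
    exact ⟨a' + b', by rw [mul_add, ha, hb, add_mul]⟩

theorem ι_mul_mul_ι (v : M) (y : ExteriorAlgebra R M) : ι R v * y * ι R v = 0 := by
  obtain ⟨y', h⟩ := exists_ι_mul_eq_mul_ι v y
  rw [h, mul_assoc, ι_sq_zero, mul_zero]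

theorem ι_mem_jacobson_bot (v : M) :
    ι R v ∈ Ideal.jacobson (⊥ : Ideal (ExteriorAlgebra R M)) := by
  refine Ideal.mem_jacobson_iff.mpr fun y => ⟨1 - y * ι R v, Ideal.mem_bot.mpr ?_⟩
  have h : y * ι R v * y * ι R v = 0 := by
    rw [mul_assoc y, mul_assoc y, ι_mul_mul_ι, mul_zero]
  rw [sub_mul, sub_mul, h, one_mul]
  abel

/-- The soul of an element of the exterior algebra lies in the Jacobson radical. -/
theorem sub_algebraMap_algebraMapInv_mem_jacobson_bot (x : ExteriorAlgebra R M) :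
    x - algebraMap R _ (algebraMapInv x) ∈
      Ideal.jacobson (⊥ : Ideal (ExteriorAlgebra R M)) := by
  induction x using ExteriorAlgebra.induction with
  | algebraMap r => simp
  | ι v => simpa [algebraMapInv] using ι_mem_jacobson_bot v
  | mul a b ha hb =>
    have h : a * b - algebraMap R _ (algebraMapInv (a * b)) =
        (a - algebraMap R _ (algebraMapInv a)) * b +
          algebraMap R _ (algebraMapInv a) * (b - algebraMap R _ (algebraMapInv b)) := by
      rw [map_mul, map_mul]
      noncomm_ring
    rw [h]
    exact add_mem (Ideal.mul_mem_right _ _ ha) (Ideal.mul_mem_left _ _ hb)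
  | add a b ha hb =>
    rw [map_add, map_add, add_sub_add_comm]
    exact add_mem ha hb

theorem mem_jacobson_bot_of_algebraMapInv_eq_zero {x : ExteriorAlgebra R M}
    (hx : algebraMapInv x = 0) : x ∈ Ideal.jacobson (⊥ : Ideal (ExteriorAlgebra R M)) := by
  simpa [hx] using sub_algebraMap_algebraMapInv_mem_jacobson_bot x

/-- A matrix whose body is the identity matrix is invertible. -/
theorem isUnit_matrix_of_mapMatrix_algebraMapInv_eq_one {n : Type*} [Fintype n] [DecidableEq n]
    {A : Matrix n n (ExteriorAlgebra R M)}
    (hA : (algebraMapInv : ExteriorAlgebra R M →ₐ[R] R).mapMatrix A = 1) : IsUnit A := by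
  refine Ideal.isUnit_of_sub_one_mem_jacobson_bot_of_ring A ?_
  rw [← Ideal.matrix_bot n]
  refine Ideal.matrix_jacobson_le _ fun i j => mem_jacobson_bot_of_algebraMapInv_eq_zero ?_
  have h : (algebraMapInv : ExteriorAlgebra R M →ₐ[R] R).mapMatrix (A - 1) = 0 := by
    rw [map_sub, map_one, hA, sub_self]
  exact congrFun (congrFun h i) j

/-- A square matrix over an exterior algebra is invertible iff its body is. -/
theorem isUnit_matrix_iff_isUnit_mapMatrix_algebraMapInv {n : Type*} [Fintype n] [DecidableEq n]
    (A : Matrix n n (ExteriorAlgebra R M)) :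
    IsUnit A ↔ IsUnit ((algebraMapInv : ExteriorAlgebra R M →ₐ[R] R).mapMatrix A) := by
  refine ⟨fun h => h.map _, fun ⟨u, hu⟩ => ?_⟩
  let f := (Algebra.ofId R (ExteriorAlgebra R M)).mapMatrix (m := n)
  have hf (B : Matrix n n R) :
      (algebraMapInv : ExteriorAlgebra R M →ₐ[R] R).mapMatrix (f B) = B := by
    ext i j
    exact algebraMap_leftInverse M (B i j)
  let w := Units.map (f : Matrix n n R →* Matrix n n (ExteriorAlgebra R M)) u⁻¹
  rw [← Units.isUnit_mul_units A w]
  refine isUnit_matrix_of_mapMatrix_algebraMapInv_eq_one ?_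
  rw [map_mul, ← hu]
  exact (congrArg _ (hf _)).trans u.mul_inv

end ExteriorAlgebra

/-- A square matrix over the Grassmann (exterior) algebra `Λ(V) = ExteriorAlgebra ℝ V`
is invertible if and only if the determinant of its body matrix (entrywise application
of the augmentation `ExteriorAlgebra.algebraMapInv`) is nonzero. -/
theorem matrix_over_exteriorAlgebra_isUnit_iff_det_body_ne_zero
    (V : Type*) [AddCommGroup V] [Module ℝ V] (N : ℕ)
    (A : Matrix (Fin N) (Fin N) (ExteriorAlgebra ℝ V)) :
    IsUnit A ↔ (A.map fun a => ExteriorAlgebra.algebraMapInv a).det ≠ 0 := by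
  rw [ExteriorAlgebra.isUnit_matrix_iff_isUnit_mapMatrix_algebraMapInv,
    Matrix.isUnit_iff_isUnit_det, isUnit_iff_ne_zero]
  rfl
end

section
/- (Removal of the soul of a nondegenerate symmetric or antisymmetric matrix by congruence.) Let R be a commutative ℝ-algebra and I ⊆ R an ideal with Iᵏ = 0 for some k ≥ 1. Let A and A₀ be N×N matrices over R such that either Aᵀ = A and A₀ᵀ = A₀, or Aᵀ = −A and A₀ᵀ = −A₀; suppose all entries of A − A₀ lie in I and A₀ is invertible. Then there exists an invertible N×N matrix P over R, with all entries of P − 1 lying in I, such that P · A · Pᵀ = A₀. -/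
open Matrix

section EntriesInIdeal

variable {R n : Type*} [CommRing R] [Fintype n] {J K : Ideal R} {M L : Matrix n n R}

theorem Matrix.mul_apply_mem_ideal_mul (hM : ∀ i j, M i j ∈ J) (hL : ∀ i j, L i j ∈ K)
    (i j : n) : (M * L) i j ∈ J * K := by
  rw [Matrix.mul_apply]
  exact Ideal.sum_mem _ fun l _ => Ideal.mul_mem_mul (hM i l) (hL l j)

theorem Matrix.mul_apply_mem_ideal_of_left (hM : ∀ i j, M i j ∈ J) (L : Matrix n n R)
    (i j : n) : (M * L) i j ∈ J := by
  rw [Matrix.mul_apply]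
  exact Ideal.sum_mem _ fun l _ => J.mul_mem_right _ (hM i l)

end EntriesInIdeal

/-- The first-order correction `1 + X`, with `X = c S A₀⁻¹`, `c = 1/2` and `S = A₀ - B`, acts on
the `ε`-symmetric matrix `B` by congruence and leaves only terms quadratic in `S`. -/
theorem Matrix.congruence_correction {R n : Type*} [CommRing R] [Fintype n] [DecidableEq n]
    {ε c : R} (hε : ε * ε = 1) (hc : c + c = 1) {A₀ B C : Matrix n n R}
    (hA₀ : A₀ᵀ = ε • A₀) (hB : Bᵀ = ε • B) (hC : C * A₀ = 1) :
    (1 + c • ((A₀ - B) * C)) * B * (1 + c • ((A₀ - B) * C))ᵀ - A₀ =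
      c • ((A₀ - B) * C) * B * (c • ((A₀ - B) * C))ᵀ
        - (c • ((A₀ - B) * C) * (A₀ - B) + (A₀ - B) * (c • ((A₀ - B) * C))ᵀ) := by
  have hS : (A₀ - B)ᵀ = ε • (A₀ - B) := by rw [transpose_sub, hA₀, hB, smul_sub]
  have hACt : A₀ * Cᵀ = ε • (1 : Matrix n n R) := by
    have h := congrArg (fun M => ε • Mᵀ) hC
    simpa [transpose_mul, hA₀, smul_smul, hε] using h
  have hX : c • ((A₀ - B) * C) * A₀ = c • (A₀ - B) := by
    rw [smul_mul_assoc, mul_assoc, hC, mul_one]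
  have hXt : A₀ * (c • ((A₀ - B) * C))ᵀ = c • (A₀ - B) := by
    rw [transpose_smul, transpose_mul, hS, mul_smul_comm, ← mul_assoc, hACt, smul_mul_smul_comm,
      one_mul, hε, one_smul]
  have hsum : c • (A₀ - B) + c • (A₀ - B) = A₀ - B := by rw [← add_smul, hc, one_smul]
  generalize c • ((A₀ - B) * C) = X at *
  have key : (1 + X) * B * (1 + X)ᵀ - A₀ - (X * B * Xᵀ - (X * (A₀ - B) + (A₀ - B) * Xᵀ)) =
      X * A₀ + A₀ * Xᵀ - (A₀ - B) := by
    rw [transpose_add, transpose_one]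
    noncomm_ring
  rw [hX, hXt, hsum, sub_self] at key
  exact sub_eq_zero.mp key

theorem Matrix.exists_congruence_sub_mem_pow {R n : Type*} [CommRing R] [Fintype n]
    [DecidableEq n] {I : Ideal R} {ε c : R} (hε : ε * ε = 1) (hc : c + c = 1)
    {A A₀ : Matrix n n R} (hA : Aᵀ = ε • A) (hA₀ : A₀ᵀ = ε • A₀)
    (hsub : ∀ i j, (A - A₀) i j ∈ I) (hunit : IsUnit A₀) (m : ℕ) :
    ∃ P : Matrix n n R, (∀ i j, (P - 1) i j ∈ I) ∧
      ∀ i j, (P * A * Pᵀ - A₀) i j ∈ I ^ (m + 1) := by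
  induction m with
  | zero => exact ⟨1, by simp, by simpa using hsub⟩
  | succ m ih =>
    obtain ⟨P, hP, hPA⟩ := ih
    obtain ⟨C, hC⟩ := hunit.exists_left_inv
    have hB : (P * A * Pᵀ)ᵀ = ε • (P * A * Pᵀ) := by
      simp [transpose_mul, hA, mul_assoc]
    have hS : ∀ i j, (A₀ - P * A * Pᵀ) i j ∈ I ^ (m + 1) := fun i j => by
      rw [← neg_sub, neg_apply]
      exact neg_mem (hPA i j)
    have hX : ∀ i j, (c • ((A₀ - P * A * Pᵀ) * C)) i j ∈ I ^ (m + 1) := fun i j =>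
      Ideal.mul_mem_left _ c (mul_apply_mem_ideal_of_left hS C i j)
    have hXt : ∀ i j, (c • ((A₀ - P * A * Pᵀ) * C))ᵀ i j ∈ I ^ (m + 1) := fun i j => hX j i
    have hcorr := congruence_correction hε hc hA₀ hB hC
    have hle : I ^ (m + 1) * I ^ (m + 1) ≤ I ^ (m + 1 + 1) := by
      rw [← pow_add]
      exact Ideal.pow_le_pow_right (by omega)
    have hle_one : I ^ (m + 1) ≤ I := Ideal.pow_le_self (Nat.succ_ne_zero m)
    generalize c • ((A₀ - P * A * Pᵀ) * C) = X at *
    refine ⟨(1 + X) * P, fun i j => ?_, fun i j => ?_⟩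
    · have h : (1 + X) * P - 1 = X * P + (P - 1) := by noncomm_ring
      rw [h]
      exact add_mem (hle_one (mul_apply_mem_ideal_of_left hX P i j)) (hP i j)
    · have h : (1 + X) * P * A * ((1 + X) * P)ᵀ = (1 + X) * (P * A * Pᵀ) * (1 + X)ᵀ := by
        simp only [transpose_mul, mul_assoc]
      rw [h, hcorr]
      exact hle (sub_mem
        (mul_apply_mem_ideal_mul (mul_apply_mem_ideal_of_left hX _) hXt i j)
        (add_mem (mul_apply_mem_ideal_mul hX hS i j) (mul_apply_mem_ideal_mul hS hXt i j)))

/-- Removal of the soul of a nondegenerate symmetric or antisymmetric matrix by a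
congruence transformation: if `A` and `A₀` are both symmetric (or both antisymmetric)
matrices over a commutative ℝ-algebra `R`, agreeing modulo a nilpotent ideal `I`, and
`A₀` is invertible, then there is an invertible matrix `P ≡ 1 (mod I)` with
`P A Pᵀ = A₀`. -/
theorem soul_removal_congruence
    (R : Type*) [CommRing R] [Algebra ℝ R]
    (I : Ideal R) (k : ℕ) (hk : 1 ≤ k) (hI : I ^ k = ⊥)
    (N : ℕ) (A A₀ : Matrix (Fin N) (Fin N) R)
    (hsym : (Aᵀ = A ∧ A₀ᵀ = A₀) ∨ (Aᵀ = -A ∧ A₀ᵀ = -A₀))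
    (hsoul : ∀ i j, (A - A₀) i j ∈ I)
    (hA₀ : IsUnit A₀) :
    ∃ P : Matrix (Fin N) (Fin N) R,
      IsUnit P ∧ (∀ i j, (P - 1) i j ∈ I) ∧ P * A * Pᵀ = A₀ := by
  obtain ⟨ε, hε, hA, hA₀'⟩ : ∃ ε : R, ε * ε = 1 ∧ Aᵀ = ε • A ∧ A₀ᵀ = ε • A₀ := by
    rcases hsym with ⟨h, h₀⟩ | ⟨h, h₀⟩
    · exact ⟨1, by simp, by simpa using h, by simpa using h₀⟩
    · exact ⟨-1, by simp, by simpa using h, by simpa using h₀⟩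
  have hc : algebraMap ℝ R (1 / 2) + algebraMap ℝ R (1 / 2) = 1 := by
    rw [← map_add, add_halves, map_one]
  obtain ⟨P, hP, hPA⟩ := exists_congruence_sub_mem_pow hε hc hA hA₀' hsoul hA₀ (k - 1)
  rw [Nat.sub_add_cancel hk, hI] at hPA
  have hPA' : P * A * Pᵀ = A₀ := sub_eq_zero.mp (Matrix.ext hPA)
  refine ⟨P, ?_, hP, hPA'⟩
  rw [← hPA', mul_assoc, isUnit_iff_isUnit_det, det_mul] at hA₀
  exact (isUnit_iff_isUnit_det P).mpr (isUnit_of_mul_isUnit_left hA₀)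
end

section
/- (Canonical form of a symmetric or antisymmetric matrix over a ring with nilpotent augmentation ideal.) Let R be a commutative ring which is an ℝ-algebra, and let π : R → ℝ be a surjective ℝ-algebra homomorphism whose kernel I satisfies Iᵏ = 0 for some k ≥ 1 (so R = ℝ·1 ⊕ I). Let A be an N×N matrix over R with Aᵀ = A (respectively Aᵀ = −A). Then there exist an integer r with 0 ≤ r ≤ N and an invertible N×N matrix P over R such that P · A · Pᵀ is block diagonal, equal to fromBlocks b 0 0 s, where b is an invertible r×r matrix over R with bᵀ = b (respectively bᵀ = −b), and s is an (N−r)×(N−r) matrix with all entries in I and sᵀ = s (respectively sᵀ = −s). -/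
open Matrix

/-- An augmentation over a field with nilpotent kernel reflects units. -/
theorem isUnit_of_map_ne_zero_of_ker_pow_eq_bot {K R : Type*} [Field K] [CommRing R] [Algebra K R]
    (π : R →ₐ[K] K) {k : ℕ} (hker : (RingHom.ker π) ^ k = ⊥) {x : R} (hx : π x ≠ 0) :
    IsUnit x := by
  have hn : IsNilpotent (x - algebraMap K R (π x)) := by
    refine ⟨k, ?_⟩
    have hmem : x - algebraMap K R (π x) ∈ RingHom.ker π := by
      simp [RingHom.mem_ker]
    simpa [hker] using Ideal.pow_mem_pow hmem k
  have hu : IsUnit (algebraMap K R (π x)) := (IsUnit.mk0 _ hx).map _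
  simpa using hn.isUnit_add_left_of_commute hu (Commute.all _ _)

theorem transpose_congruence {m n R : Type*} [Fintype n] [CommRing R]
    {A : Matrix n n R} {ε : R} (hA : Aᵀ = ε • A) (P : Matrix m n R) :
    (P * A * Pᵀ)ᵀ = ε • (P * A * Pᵀ) := by
  simp [transpose_mul, hA, Matrix.mul_assoc]

theorem exists_basis_of_isCompl {K V : Type*} [Field K] [AddCommGroup V] [Module K V]
    [FiniteDimensional K V] {W L : Submodule K V} (h : IsCompl W L) {p q : ℕ}
    (hp : Module.finrank K W = p) (hq : Module.finrank K L = q) :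
    ∃ v : Module.Basis (Fin p ⊕ Fin q) K V,
      (∀ i, v (Sum.inl i) ∈ W) ∧ ∀ j, v (Sum.inr j) ∈ L := by
  refine ⟨((Module.finBasisOfFinrankEq K W hp).prod (Module.finBasisOfFinrankEq K L hq)).map
    (Submodule.prodEquivOfIsCompl W L h), fun i => ?_, fun j => ?_⟩ <;>
  simp [Module.Basis.prod_apply]

/-- Over a field, a matrix proportional to its transpose is congruent to the direct sum of an
invertible block and a zero block. -/
theorem exists_congruence_fromBlocks_zero {K : Type*} [Field K] {N : ℕ} {c : K}
    {A : Matrix (Fin N) (Fin N) K} (hA : Aᵀ = c • A) :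
    ∃ (r : ℕ) (_ : r ≤ N) (Q : Matrix (Fin r ⊕ Fin (N - r)) (Fin N) K)
      (Q' : Matrix (Fin N) (Fin r ⊕ Fin (N - r)) K) (b : Matrix (Fin r) (Fin r) K),
      Q * Q' = 1 ∧ IsUnit b ∧ Q * A * Qᵀ = fromBlocks b 0 0 0 := by
  obtain ⟨W, hW⟩ := (LinearMap.ker A.mulVecLin).exists_isCompl
  have hfin := Submodule.finrank_add_eq_of_isCompl hW
  rw [Module.finrank_fin_fun] at hfin
  have hr : Module.finrank K W ≤ N := by omega
  obtain ⟨v, hvW, hvK⟩ := exists_basis_of_isCompl hW.symm rfl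
    (show Module.finrank K (LinearMap.ker A.mulVecLin) = N - Module.finrank K W by omega)
  replace hvK (j) : A *ᵥ v (Sum.inr j) = 0 := by simpa using hvK j
  generalize Module.finrank K W = r at *
  let Q : Matrix (Fin r ⊕ Fin (N - r)) (Fin N) K := of v
  let Q' := (v.toMatrix (Pi.basisFun K (Fin N)))ᵀ
  have hQ : Q = ((Pi.basisFun K (Fin N)).toMatrix v)ᵀ := by
    ext i j; simp [Q, Module.Basis.toMatrix_apply]
  have hQQ' : Q * Q' = 1 := by
    rw [hQ, ← transpose_mul, Module.Basis.toMatrix_mul_toMatrix_flip, transpose_one]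
  have hQ'Q : Q' * Q = 1 := by
    rw [hQ, ← transpose_mul, Module.Basis.toMatrix_mul_toMatrix_flip, transpose_one]
  have hcol (i j) : (Q * A * Qᵀ) i (Sum.inr j) = 0 := by
    have : (Q * A * Qᵀ) i (Sum.inr j) = Q i ⬝ᵥ (A *ᵥ v (Sum.inr j)) := by
      rw [Matrix.mul_assoc]; rfl
    rw [this, hvK, dotProduct_zero]
  have hrow (i j) : (Q * A * Qᵀ) (Sum.inr i) j = 0 := by
    have := congrFun (congrFun (transpose_congruence hA Q) j) (Sum.inr i)
    rwa [transpose_apply, Matrix.smul_apply, hcol, smul_zero] at this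
  have hblocks : Q * A * Qᵀ = fromBlocks (Q * A * Qᵀ).toBlocks₁₁ 0 0 0 := by
    ext (i | i) (j | j) <;> simp [toBlocks₁₁, hcol, hrow]
  refine ⟨_, hr, Q, Q', (Q * A * Qᵀ).toBlocks₁₁, hQQ', ?_, hblocks⟩
  rw [← mulVec_injective_iff_isUnit, ← coe_mulVecLin, ← LinearMap.ker_eq_bot, LinearMap.ker_eq_bot']
  intro x hx
  rw [mulVecLin_apply] at hx
  set y : Fin N → K := Qᵀ *ᵥ Sum.elim x 0 with hy
  have hAy : A *ᵥ y = 0 := by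
    have h0 : (Q * A * Qᵀ) *ᵥ Sum.elim x 0 = 0 := by
      rw [hblocks, fromBlocks_mulVec]; ext (i | i) <;> simp [Function.comp_def, hx]
    have := congrArg (Q' *ᵥ ·) h0
    simpa [mulVec_mulVec, ← Matrix.mul_assoc, hQ'Q, hy] using this
  have hyW : y ∈ W := by
    have : y = ∑ i, x i • v (Sum.inl i) := by
      ext j
      simp [hy, mulVec, dotProduct, Q, mul_comm]
    rw [this]
    exact W.sum_mem fun i _ => W.smul_mem _ (hvW i)
  have hy0 : y = 0 :=
    Submodule.disjoint_def.mp hW.disjoint y (by simpa using hAy) hyW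
  have hx0 : Sum.elim x 0 = (0 : Fin r ⊕ Fin (N - r) → K) := by
    have := congrArg (Q'ᵀ *ᵥ ·) hy0
    simpa [hy, mulVec_mulVec, ← transpose_mul, hQQ'] using this
  ext i
  simpa using congrFun hx0 (Sum.inl i)

/-- A matrix whose transpose is `ε` times itself and with invertible upper left block is
congruent to the direct sum of that block and its Schur complement. -/
theorem exists_congruence_schur_complement {m n R : Type*} [Fintype m] [Fintype n]
    [DecidableEq m] [DecidableEq n] [CommRing R] {ε : R}
    {b : Matrix m m R} {C : Matrix m n R} {D : Matrix n m R} {S : Matrix n n R} (hb : IsUnit b)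
    (hM : (fromBlocks b C D S)ᵀ = ε • fromBlocks b C D S) :
    ∃ U U' : Matrix (m ⊕ n) (m ⊕ n) R, U * U' = 1 ∧
      U * fromBlocks b C D S * Uᵀ = fromBlocks b 0 0 (S - D * b⁻¹ * C) := by
  have hb' : IsUnit b.det := (isUnit_iff_isUnit_det b).mp hb
  refine ⟨fromBlocks 1 0 (-(D * b⁻¹)) 1, fromBlocks 1 0 (D * b⁻¹) 1, ?_, ?_⟩
  · simp [fromBlocks_multiply]
  have hmul : (fromBlocks 1 0 (-(D * b⁻¹)) 1 : Matrix (m ⊕ n) (m ⊕ n) R) * fromBlocks b C D S *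
      (fromBlocks 1 0 (-(D * b⁻¹)) 1)ᵀ =
        fromBlocks b (b * (-(D * b⁻¹))ᵀ + C) 0 (S - D * b⁻¹ * C) := by
    simp only [fromBlocks_transpose, fromBlocks_multiply]
    simp [Matrix.mul_assoc, nonsing_inv_mul b hb', sub_eq_neg_add]
  have hsymm := transpose_congruence hM
    (fromBlocks 1 0 (-(D * b⁻¹)) 1 : Matrix (m ⊕ n) (m ⊕ n) R)
  rw [hmul] at hsymm ⊢
  rw [fromBlocks_transpose, fromBlocks_smul, fromBlocks_inj] at hsymm
  have h : b * (-(D * b⁻¹))ᵀ + C = 0 := by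
    simpa only [smul_zero, transpose_eq_zero] using hsymm.2.2.1
  rw [h]

/-- Canonical form of a symmetric (`ε = 1`) or antisymmetric (`ε = -1`) matrix over a
commutative ℝ-algebra `R` with a surjective augmentation `π : R → ℝ` whose kernel is
nilpotent: there is an invertible congruence transformation `P` bringing `A` to a block
diagonal form `fromBlocks b 0 0 s` with `b` invertible and (anti)symmetric, and `s`
(anti)symmetric with all entries in the kernel of `π` (pure soul). -/
theorem canonical_form_symmetric_antisymmetric_matrix
    (R : Type*) [CommRing R] [Algebra ℝ R]
    (π : R →ₐ[ℝ] ℝ) (hπ : Function.Surjective π)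
    (k : ℕ) (hk : 1 ≤ k) (hker : (RingHom.ker π) ^ k = ⊥)
    (N : ℕ) (ε : R) (hε : ε = 1 ∨ ε = -1)
    (A : Matrix (Fin N) (Fin N) R) (hA : Aᵀ = ε • A) :
    ∃ (r : ℕ) (hr : r ≤ N) (P : Matrix (Fin N) (Fin N) R)
      (b : Matrix (Fin r) (Fin r) R) (s : Matrix (Fin (N - r)) (Fin (N - r)) R),
      IsUnit P ∧ IsUnit b ∧ bᵀ = ε • b ∧ sᵀ = ε • s ∧
      (∀ i j, s i j ∈ RingHom.ker π) ∧
      Matrix.reindex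
          ((finCongr (Nat.add_sub_cancel' hr).symm).trans finSumFinEquiv.symm)
          ((finCongr (Nat.add_sub_cancel' hr).symm).trans finSumFinEquiv.symm)
          (P * A * Pᵀ)
        = Matrix.fromBlocks b 0 0 s := by
  have hA0 : (A.map π)ᵀ = π ε • A.map π := by
    rw [← transpose_map, hA]
    ext i j; simp
  obtain ⟨r, hr, Q, Q', b₀, hQQ', hb₀, hQA⟩ := exists_congruence_fromBlocks_zero hA0
  set ι := algebraMap ℝ R
  have hπι (x : ℝ) : π (ι x) = x := π.commutes x
  set M := Q.map ι * A * (Q.map ι)ᵀ with hM_def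
  have hM : Mᵀ = ε • M := transpose_congruence hA _
  have hπM : M.map π = fromBlocks b₀ 0 0 0 := by
    rw [← hQA, hM_def, Matrix.map_mul, Matrix.map_mul, transpose_map, Matrix.map_map]
    have : Q.map (π ∘ ι) = Q := by ext i j; simp [hπι]
    rw [this]
  obtain ⟨b, C, D, S, hMb⟩ : ∃ b C D S, M = fromBlocks b C D S :=
    ⟨_, _, _, _, (fromBlocks_toBlocks M).symm⟩
  rw [hMb, fromBlocks_map, fromBlocks_inj] at hπM
  obtain ⟨hπb, hπC, -, hπS⟩ := hπM
  have hb : IsUnit b := by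
    rw [isUnit_iff_isUnit_det]
    refine isUnit_of_map_ne_zero_of_ker_pow_eq_bot π hker ?_
    have hdet : π b.det = b₀.det := by rw [← hπb]; exact RingHom.map_det (π : R →+* ℝ) b
    rw [hdet]
    exact ((isUnit_iff_isUnit_det _).mp hb₀).ne_zero
  rw [hMb] at hM
  obtain ⟨U, U', hUU', hU⟩ := exists_congruence_schur_complement hb hM
  have hsymm := transpose_congruence hM U
  rw [hU, fromBlocks_transpose, fromBlocks_smul, fromBlocks_inj] at hsymm
  let e : Fin N ≃ Fin r ⊕ Fin (N - r) :=
    (finCongr (Nat.add_sub_cancel' hr).symm).trans finSumFinEquiv.symm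
  have hinv : (U * Q.map ι) * (Q'.map ι * U') = 1 := by
    have h : Q.map ι * Q'.map ι = 1 := by
      rw [← Matrix.map_mul, hQQ', Matrix.map_one _ (map_zero ι) (map_one ι)]
    rw [Matrix.mul_assoc, ← Matrix.mul_assoc (Q.map ι), h, Matrix.one_mul, hUU']
  refine ⟨r, hr, (U * Q.map ι).submatrix e id, b, S - D * b⁻¹ * C, ?_, hb, hsymm.1,
    hsymm.2.2.2, ?_, ?_⟩
  · refine (isUnit_iff_isUnit_det _).mpr (isUnit_det_of_right_inverse
      (B := (Q'.map ι * U').submatrix id e) ?_)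
    rw [← submatrix_mul _ _ e id e Function.bijective_id, hinv, submatrix_one_equiv]
  · intro i j
    have hC (l) : π (C l j) = 0 := congrFun (congrFun hπC l) j
    have hS : π (S i j) = 0 := congrFun (congrFun hπS i) j
    rw [RingHom.mem_ker, Matrix.sub_apply, mul_apply]
    simp [hC, hS]
  · change reindex e e _ = _
    have hP : reindex e e ((U * Q.map ι).submatrix e id * A * ((U * Q.map ι).submatrix e id)ᵀ) =
        U * Q.map ι * A * (U * Q.map ι)ᵀ := by
      ext i j
      simp only [reindex_apply, submatrix_apply, mul_apply, transpose_apply, id_eq,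
        Equiv.apply_symm_apply]
    rw [hP, ← hU, ← hMb, hM_def, transpose_mul]
    simp only [Matrix.mul_assoc]
end
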